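/- arXiv:1003.2165 — 8 statements merged into one kernel-verified Lean document; each statement's English description precedes it below -/
import Mathlib

section
/- Let 1 < B < C, let k ≥ 1 and 0 ≤ j < k be integers, and let x be in case (k, j). Then κ_{B,C}^k(x) = Σ_{p prime, x/(B^{k−1−j}C^j) < p ≤ C} κ_{B,C}^{k−1}(x/p) + Σ_{p prime, B < p ≤ x/(B^{k−1−j}C^j)} κ_{B,C}^{k−1}(x/p); moreover, for every prime p occurring in the first sum the quotient x/p is in case (k−1, j−1), and for every prime p occurring in the second sum the quotient x/p is in case (k−1, j). -/
open MeasureTheory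

open Classical in
/-- The finite set of primes `p` with `B < p ≤ C`. -/
noncomputable def primesIn (B C : ℝ) : Finset ℕ :=
  (Finset.range (⌊C⌋₊ + 1)).filter fun p => p.Prime ∧ B < (p : ℝ) ∧ (p : ℝ) ≤ C

/-- `kappa B C k x` counts `k`-tuples of primes in `(B, C]` with product at most `x`. -/
noncomputable def kappa (B C : ℝ) (k : ℕ) (x : ℝ) : ℕ :=
  Set.ncard {p : Fin k → ℕ |
    (∀ i, (p i).Prime ∧ B < (p i : ℝ) ∧ (p i : ℝ) ≤ C) ∧ ((∏ i, p i : ℕ) : ℝ) ≤ x}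

/-- `x` is in case `(k, j)`: case `(k, -1)` means `0 ≤ x < B^k`; case `(k, j)` for
`0 ≤ j < k` means `B^{k-j} C^j ≤ x < B^{k-1-j} C^{j+1}`; case `(k, k)` means `C^k ≤ x`. -/
noncomputable def inCase (B C : ℝ) (k : ℕ) (j : ℤ) (x : ℝ) : Prop :=
  if j < 0 then 0 ≤ x ∧ x < B ^ (k : ℝ)
  else if (k : ℤ) ≤ j then C ^ (k : ℝ) ≤ x
  else B ^ ((k : ℝ) - (j : ℝ)) * C ^ (j : ℝ) ≤ x ∧
       x < B ^ ((k : ℝ) - 1 - (j : ℝ)) * C ^ ((j : ℝ) + 1)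

theorem mem_primesIn {B C : ℝ} {p : ℕ} :
    p ∈ primesIn B C ↔ p.Prime ∧ B < (p : ℝ) ∧ (p : ℝ) ≤ C := by
  simp only [primesIn, Finset.mem_filter, Finset.mem_range, and_iff_right_iff_imp]
  exact fun h => Nat.lt_succ_of_le (Nat.le_floor h.2.2)

open Classical in
theorem kappa_eq_card (B C : ℝ) (k : ℕ) (x : ℝ) :
    kappa B C k x = ((Fintype.piFinset fun _ : Fin k => primesIn B C).filter
      fun p => ((∏ i, p i : ℕ) : ℝ) ≤ x).card := by
  rw [kappa, ← Set.ncard_coe_finset]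
  congr 1
  ext p
  simp [mem_primesIn]

theorem kappa_succ (B C : ℝ) (k : ℕ) (x : ℝ) :
    kappa B C (k + 1) x = ∑ p ∈ primesIn B C, kappa B C k (x / (p : ℝ)) := by
  classical
  rw [kappa_eq_card, Finset.card_eq_sum_card_fiberwise (f := fun p => p 0) (t := primesIn B C)]
  · refine Finset.sum_congr rfl fun p hp => ?_
    have hp0 : (0 : ℝ) < p := by exact_mod_cast (mem_primesIn.1 hp).1.pos
    rw [kappa_eq_card]
    refine Finset.card_nbij' (fun f => Fin.tail f) (fun g => Fin.cons p g) ?_ ?_ ?_ ?_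
    · intro f hf
      simp only [Finset.coe_filter, Finset.mem_filter, Fintype.mem_piFinset, Set.mem_ofPred_eq,
        Fin.prod_univ_succ] at hf ⊢
      obtain ⟨⟨hf, hx⟩, rfl⟩ := hf
      refine ⟨fun i => hf i.succ, ?_⟩
      rw [le_div_iff₀' hp0]
      simpa [Fin.tail] using hx
    · intro g hg
      simp only [Finset.coe_filter, Finset.mem_filter, Fintype.mem_piFinset, Set.mem_ofPred_eq,
        Fin.prod_univ_succ, Fin.cons_zero, Fin.cons_succ, and_true] at hg ⊢
      refine ⟨Fin.cases hp hg.1, ?_⟩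
      have := hg.2
      rw [le_div_iff₀' hp0] at this
      exact_mod_cast this
    · intro f hf
      obtain ⟨-, rfl⟩ := Finset.mem_filter.1 hf
      exact Fin.cons_self_tail f
    · intro g _
      exact Fin.tail_cons _ _
  · intro f hf
    exact Fintype.mem_piFinset.1 (Finset.mem_filter.1 hf).1 0

theorem sum_primesIn_add_sum_primesIn {B q C : ℝ} (hBq : B ≤ q) (hqC : q ≤ C) (f : ℕ → ℕ) :
    ∑ p ∈ primesIn B C, f p = ∑ p ∈ primesIn q C, f p + ∑ p ∈ primesIn B q, f p := by
  classical
  rw [← Finset.sum_union]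
  · refine Finset.sum_congr ?_ fun _ _ => rfl
    ext p
    simp only [Finset.mem_union, mem_primesIn]
    constructor
    · rintro ⟨h, hB, hC⟩
      rcases lt_or_ge q (p : ℝ) with hq | hq
      · exact Or.inl ⟨h, hq, hC⟩
      · exact Or.inr ⟨h, hB, hq⟩
    · rintro (⟨h, hq, hC⟩ | ⟨h, hB, hq⟩)
      · exact ⟨h, hBq.trans_lt hq, hC⟩
      · exact ⟨h, hB, hq.trans hqC⟩
  · refine Finset.disjoint_left.2 fun p h₁ h₂ => ?_
    exact absurd (mem_primesIn.1 h₁).2.1 (mem_primesIn.1 h₂).2.2.not_gt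

theorem kappa_case_split (B C : ℝ) (hB : 1 < B) (hBC : B < C)
    (k j : ℕ) (hk : 1 ≤ k) (hj : j < k) (x : ℝ)
    (hx : inCase B C k (j : ℤ) x) :
    (kappa B C k x =
      (∑ p ∈ primesIn (x / (B ^ ((k : ℝ) - 1 - (j : ℝ)) * C ^ (j : ℝ))) C,
        kappa B C (k - 1) (x / (p : ℝ))) +
      (∑ p ∈ primesIn B (x / (B ^ ((k : ℝ) - 1 - (j : ℝ)) * C ^ (j : ℝ))),
        kappa B C (k - 1) (x / (p : ℝ)))) ∧
    (∀ p ∈ primesIn (x / (B ^ ((k : ℝ) - 1 - (j : ℝ)) * C ^ (j : ℝ))) C,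
      inCase B C (k - 1) ((j : ℤ) - 1) (x / (p : ℝ))) ∧
    (∀ p ∈ primesIn B (x / (B ^ ((k : ℝ) - 1 - (j : ℝ)) * C ^ (j : ℝ))),
      inCase B C (k - 1) (j : ℤ) (x / (p : ℝ))) := by
  obtain ⟨n, rfl⟩ : ∃ n, k = n + 1 := ⟨k - 1, by omega⟩
  have hB0 : 0 < B := by linarith
  have hC0 : 0 < C := by linarith
  have hxBC : B ^ ((n : ℝ) - j) * C ^ (j : ℝ) * B ≤ x ∧
      x < B ^ ((n : ℝ) - j) * C ^ (j : ℝ) * C := by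
    rw [inCase, if_neg (by omega), if_neg (by omega)] at hx
    push_cast at hx
    rw [show (n : ℝ) + 1 - j = ((n : ℝ) - j) + 1 by ring,
      show (n : ℝ) + 1 - 1 - j = (n : ℝ) - j by ring,
      Real.rpow_add_one hB0.ne', Real.rpow_add_one hC0.ne'] at hx
    constructor <;> linarith [hx.1, hx.2]
  have hexp : ((n + 1 : ℕ) : ℝ) - 1 - (j : ℝ) = (n : ℝ) - j := by push_cast; ring
  rw [hexp, Nat.add_sub_cancel]
  set M := B ^ ((n : ℝ) - j) * C ^ (j : ℝ) with hM
  have hM0 : 0 < M := by positivity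
  have hBq : B ≤ x / M := (le_div_iff₀' hM0).2 hxBC.1
  have hqC : x / M < C := (div_lt_iff₀' hM0).2 hxBC.2
  have hx0 : 0 < x := lt_of_lt_of_le (by positivity) hxBC.1
  refine ⟨?_, fun p hp => ?_, fun p hp => ?_⟩
  · rw [kappa_succ]
    exact sum_primesIn_add_sum_primesIn hBq hqC.le _
  · obtain ⟨hpp, hqp, hpC⟩ := mem_primesIn.1 hp
    have hp0 : (0 : ℝ) < p := by exact_mod_cast hpp.pos
    have hlt : x / p < M := by
      rw [div_lt_iff₀ hM0] at hqp
      exact (div_lt_iff₀' hp0).2 hqp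
    unfold inCase
    rcases Nat.eq_zero_or_pos j with rfl | hj0
    · rw [if_pos (by simp)]
      refine ⟨by positivity, ?_⟩
      simpa [hM] using hlt
    · rw [if_neg (by omega), if_neg (by omega)]
      push_cast
      have hMB : B ^ ((n : ℝ) - (j - 1)) * C ^ ((j : ℝ) - 1) * C = M * B := by
        rw [hM, show (n : ℝ) - (j - 1) = ((n : ℝ) - j) + 1 by ring,
          Real.rpow_add_one hB0.ne', Real.rpow_sub_one hC0.ne']
        field_simp
      refine ⟨?_, ?_⟩
      · rw [le_div_iff₀ hp0]
        refine le_trans ?_ (hMB.trans_le hxBC.1)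
        gcongr
      · rwa [show (n : ℝ) - 1 - (j - 1) = (n : ℝ) - j by ring, sub_add_cancel]
  · obtain ⟨hpp, hBp, hpq⟩ := mem_primesIn.1 hp
    have hp0 : (0 : ℝ) < p := by exact_mod_cast hpp.pos
    have hle : M ≤ x / p := by
      rw [le_div_iff₀ hM0] at hpq
      exact (le_div_iff₀' hp0).2 hpq
    unfold inCase
    rw [if_neg (by omega)]
    split_ifs with hnj
    · obtain rfl : n = j := by omega
      simpa [hM] using hle
    · push_cast
      refine ⟨hle, ?_⟩
      rw [div_lt_iff₀ hp0]
      have hMC : B ^ ((n : ℝ) - 1 - j) * C ^ ((j : ℝ) + 1) * B = M * C := by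
        rw [hM, show (n : ℝ) - 1 - j = ((n : ℝ) - j) - 1 by ring,
          Real.rpow_sub_one hB0.ne', Real.rpow_add_one hC0.ne']
        field_simp
      refine (hxBC.2.trans_eq hMC.symm).trans ?_
      gcongr
end

section
/- Let B > 1, α > 0 and C = B^{1+α}, and let k ≥ 1 be an integer. Then for every real x > 0 one has (1+α)^{−k}·λ̃^k(x) ≤ κ̃^k(x) ≤ λ̃^k(x) and (1+α)^{−k}·λ̂^k(x) ≤ κ̂^k(x) ≤ λ̂^k(x). -/
open MeasureTheory

/-- The error bound `Ê(t) = (1/(8π)) √t ln t` from the conditional prime number theorem. -/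
noncomputable def Ehat (t : ℝ) : ℝ := 1 / (8 * Real.pi) * Real.sqrt t * Real.log t

/-- The approximation `κ̃^k` of the counting function. -/
noncomputable def ktil (B C : ℝ) : ℕ → ℝ → ℝ
  | 0 => fun x => if 1 ≤ x then 1 else 0
  | k + 1 => fun x => ∫ p in B..C, ktil B C k (x / p) / Real.log p

/-- The error bounding function `κ̂^k`. -/
noncomputable def khat (B C : ℝ) : ℕ → ℝ → ℝ
  | 0 => fun _ => 0
  | k + 1 => fun x =>
      (∫ p in B..C, khat B C k (x / p) / Real.log p)
      + 2 * (ktil B C k (x / B) + khat B C k (x / B)) * Ehat B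
      + ∫ p in B..C, (ktil B C k (x / p) + khat B C k (x / p)) * deriv Ehat p

/-- The simplified approximation `λ̃^k` (with `1/ln p` replaced by `1/ln B`). -/
noncomputable def lamtil (B C : ℝ) : ℕ → ℝ → ℝ
  | 0 => fun x => if 1 ≤ x then 1 else 0
  | k + 1 => fun x => (Real.log B)⁻¹ * ∫ p in B..C, lamtil B C k (x / p)

/-- The simplified error bounding function `λ̂^k`. -/
noncomputable def lamhat (B C : ℝ) : ℕ → ℝ → ℝ
  | 0 => fun _ => 0
  | k + 1 => fun x =>
      (Real.log B)⁻¹ * (∫ p in B..C, lamhat B C k (x / p))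
      + 2 * (lamtil B C k (x / B) + lamhat B C k (x / B)) * Ehat B
      + ∫ p in B..C, (lamtil B C k (x / p) + lamhat B C k (x / p)) * deriv Ehat p

/-- Nonnegative and monotone on the positive reals. -/
def PosMono (f : ℝ → ℝ) : Prop :=
  MonotoneOn f (Set.Ioi 0) ∧ ∀ x, 0 < x → 0 ≤ f x

namespace PosMono

variable {f g : ℝ → ℝ} {B C x : ℝ} {w : ℝ → ℝ}

theorem add (hf : PosMono f) (hg : PosMono g) : PosMono (fun x => f x + g x) :=
  ⟨hf.1.add hg.1, fun x hx => add_nonneg (hf.2 x hx) (hg.2 x hx)⟩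

theorem mul_const (hf : PosMono f) {c : ℝ} (hc : 0 ≤ c) : PosMono (fun x => f x * c) :=
  ⟨fun _ ha _ hb hab => mul_le_mul_of_nonneg_right (hf.1 ha hb hab) hc,
    fun x hx => mul_nonneg (hf.2 x hx) hc⟩

theorem comp_div (hf : PosMono f) (hB : 0 < B) : PosMono (fun x => f (x / B)) :=
  ⟨fun _ ha _ hb hab => hf.1 (div_pos ha hB) (div_pos hb hB) (by gcongr),
    fun _ hx => hf.2 _ (div_pos hx hB)⟩

theorem intervalIntegrable (hf : PosMono f) (hB : 0 < B) (hBC : B ≤ C) (hx : 0 < x)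
    (hw : ContinuousOn w (Set.Icc B C)) :
    IntervalIntegrable (fun p => f (x / p) * w p) volume B C := by
  rw [← Set.uIcc_of_le hBC] at hw
  refine IntervalIntegrable.mul_continuousOn (AntitoneOn.intervalIntegrable ?_) hw
  rw [Set.uIcc_of_le hBC]
  intro a ha b hb hab
  have ha' : 0 < a := hB.trans_le ha.1
  have hb' : 0 < b := hB.trans_le hb.1
  exact hf.1 (div_pos hx hb') (div_pos hx ha') (by gcongr)

theorem integral (hf : PosMono f) (hB : 0 < B) (hBC : B ≤ C)
    (hw : ContinuousOn w (Set.Icc B C)) (hw0 : ∀ p ∈ Set.Icc B C, 0 ≤ w p) :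
    PosMono (fun x => ∫ p in B..C, f (x / p) * w p) := by
  refine ⟨fun a ha b hb hab => ?_, fun x hx => ?_⟩
  · refine intervalIntegral.integral_mono_on hBC (hf.intervalIntegrable hB hBC ha hw)
      (hf.intervalIntegrable hB hBC hb hw) fun p hp => ?_
    exact mul_le_mul_of_nonneg_right ((hf.comp_div (hB.trans_le hp.1)).1 ha hb hab) (hw0 p hp)
  · exact intervalIntegral.integral_nonneg hBC fun p hp =>
      mul_nonneg (hf.2 _ (div_pos hx (hB.trans_le hp.1))) (hw0 p hp)

end PosMono

theorem integral_div_mono {f g v w : ℝ → ℝ} {B C x c : ℝ} (hf : PosMono f) (hg : PosMono g)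
    (hB : 0 < B) (hBC : B ≤ C) (hx : 0 < x)
    (hv : ContinuousOn v (Set.Icc B C)) (hw : ContinuousOn w (Set.Icc B C))
    (h : ∀ p ∈ Set.Icc B C, c * (f (x / p) * v p) ≤ g (x / p) * w p) :
    c * ∫ p in B..C, f (x / p) * v p ≤ ∫ p in B..C, g (x / p) * w p := by
  rw [← intervalIntegral.integral_const_mul]
  exact intervalIntegral.integral_mono_on hBC
    ((hf.intervalIntegrable hB hBC hx hv).const_mul c) (hg.intervalIntegrable hB hBC hx hw) h

theorem hasDerivAt_Ehat {t : ℝ} (ht : 0 < t) :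
    HasDerivAt Ehat
      (1 / (8 * Real.pi) * (1 / (2 * √t)) * Real.log t + 1 / (8 * Real.pi) * √t * t⁻¹) t :=
  ((Real.hasDerivAt_sqrt ht.ne').const_mul _).mul (Real.hasDerivAt_log ht.ne')

theorem deriv_Ehat_nonneg {t : ℝ} (ht : 1 ≤ t) : 0 ≤ deriv Ehat t := by
  have h0 : 0 < t := by linarith
  have := Real.log_nonneg ht
  rw [(hasDerivAt_Ehat h0).deriv]
  positivity

theorem continuousOn_deriv_Ehat : ContinuousOn (deriv Ehat) (Set.Ioi 0) := by
  refine ContinuousOn.congr (f := fun t =>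
    1 / (8 * Real.pi) * (1 / (2 * √t)) * Real.log t + 1 / (8 * Real.pi) * √t * t⁻¹) ?_
    fun t ht => (hasDerivAt_Ehat ht).deriv
  intro t ht
  have h0 : t ≠ 0 := (Set.mem_Ioi.mp ht).ne'
  have h1 : 2 * √t ≠ 0 := by
    have := Real.sqrt_pos.mpr ht
    positivity
  have h2 : ContinuousAt (fun t : ℝ => 1 / (2 * √t)) t :=
    continuousAt_const.div (by fun_prop) h1
  have h3 : ContinuousAt Real.log t := Real.continuousAt_log h0
  have h4 : ContinuousAt (fun t : ℝ => t⁻¹) t := continuousAt_inv₀ h0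
  exact (((continuousAt_const.mul h2).mul h3).add
    ((continuousAt_const.mul Real.continuous_sqrt.continuousAt).mul h4)).continuousWithinAt

theorem Ehat_nonneg {t : ℝ} (ht : 1 ≤ t) : 0 ≤ Ehat t := by
  have := Real.log_nonneg ht
  unfold Ehat
  positivity

theorem posMono_step : PosMono (fun x => if 1 ≤ x then 1 else 0) := by
  refine ⟨fun a _ b _ hab => ?_, fun x _ => ?_⟩
  · dsimp only
    split_ifs <;> linarith
  · dsimp only
    split_ifs <;> norm_num

section Recursion

variable {B C : ℝ}

theorem ktil_succ (k : ℕ) (x : ℝ) :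
    ktil B C (k + 1) x = ∫ p in B..C, ktil B C k (x / p) * (Real.log p)⁻¹ := rfl

theorem khat_succ (k : ℕ) (x : ℝ) :
    khat B C (k + 1) x = (∫ p in B..C, khat B C k (x / p) * (Real.log p)⁻¹)
      + (ktil B C k (x / B) + khat B C k (x / B)) * (2 * Ehat B)
      + ∫ p in B..C, (ktil B C k (x / p) + khat B C k (x / p)) * deriv Ehat p := by
  simp only [khat, div_eq_mul_inv]
  ring

theorem lamtil_succ (k : ℕ) (x : ℝ) :
    lamtil B C (k + 1) x = ∫ p in B..C, lamtil B C k (x / p) * (Real.log B)⁻¹ := by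
  rw [intervalIntegral.integral_mul_const, mul_comm]
  rfl

theorem lamhat_succ (k : ℕ) (x : ℝ) :
    lamhat B C (k + 1) x = (∫ p in B..C, lamhat B C k (x / p) * (Real.log B)⁻¹)
      + (lamtil B C k (x / B) + lamhat B C k (x / B)) * (2 * Ehat B)
      + ∫ p in B..C, (lamtil B C k (x / p) + lamhat B C k (x / p)) * deriv Ehat p := by
  rw [intervalIntegral.integral_mul_const]
  simp only [lamhat]
  ring

theorem continuousOn_inv_log (hB : 1 < B) :
    ContinuousOn (fun p => (Real.log p)⁻¹) (Set.Icc B C) := by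
  refine ContinuousOn.inv₀ (Real.continuousOn_log.mono fun p hp => ?_) fun p hp => ?_
  · exact (zero_lt_one.trans (hB.trans_le hp.1)).ne'
  · exact (Real.log_pos (hB.trans_le hp.1)).ne'

theorem continuousOn_deriv_Ehat_Icc (hB : 1 < B) :
    ContinuousOn (deriv Ehat) (Set.Icc B C) :=
  continuousOn_deriv_Ehat.mono fun _ hp => zero_lt_one.trans (hB.trans_le hp.1)

theorem posMono_ktil_khat (hB : 1 < B) (hBC : B ≤ C) (k : ℕ) :
    PosMono (ktil B C k) ∧ PosMono (khat B C k) := by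
  have h0 : 0 < B := by linarith
  have hlog : ∀ p ∈ Set.Icc B C, 0 ≤ (Real.log p)⁻¹ := fun p hp =>
    inv_nonneg.mpr (Real.log_nonneg (hB.le.trans hp.1))
  induction k with
  | zero => exact ⟨posMono_step, fun _ _ _ _ _ => le_rfl, fun _ _ => le_rfl⟩
  | succ k ih =>
    obtain ⟨h1, h2⟩ := ih
    refine ⟨h1.integral h0 hBC (continuousOn_inv_log hB) hlog, ?_⟩
    rw [funext (khat_succ k)]
    exact ((h2.integral h0 hBC (continuousOn_inv_log hB) hlog).add
      (((h1.add h2).comp_div h0).mul_const (mul_nonneg zero_le_two (Ehat_nonneg hB.le)))).add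
      ((h1.add h2).integral h0 hBC (continuousOn_deriv_Ehat_Icc hB)
        fun p hp => deriv_Ehat_nonneg (hB.le.trans hp.1))

theorem posMono_lamtil_lamhat (hB : 1 < B) (hBC : B ≤ C) (k : ℕ) :
    PosMono (lamtil B C k) ∧ PosMono (lamhat B C k) := by
  have h0 : 0 < B := by linarith
  have hlog : 0 ≤ (Real.log B)⁻¹ := inv_nonneg.mpr (Real.log_nonneg hB.le)
  induction k with
  | zero => exact ⟨posMono_step, fun _ _ _ _ _ => le_rfl, fun _ _ => le_rfl⟩
  | succ k ih =>
    obtain ⟨h1, h2⟩ := ih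
    rw [funext (lamtil_succ k), funext (lamhat_succ k)]
    exact ⟨h1.integral h0 hBC continuousOn_const fun _ _ => hlog,
      ((h2.integral h0 hBC continuousOn_const fun _ _ => hlog).add
      (((h1.add h2).comp_div h0).mul_const (mul_nonneg zero_le_two (Ehat_nonneg hB.le)))).add
      ((h1.add h2).integral h0 hBC (continuousOn_deriv_Ehat_Icc hB)
        fun p hp => deriv_Ehat_nonneg (hB.le.trans hp.1))⟩

end Recursion

theorem ktil_khat_vs_lamtil_lamhat (B α C : ℝ) (hB : 1 < B) (hα : 0 < α)
    (hC : C = B ^ (1 + α)) (k : ℕ) (hk : 1 ≤ k) (x : ℝ) (hx : 0 < x) :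
    ((1 + α) ^ k)⁻¹ * lamtil B C k x ≤ ktil B C k x ∧
    ktil B C k x ≤ lamtil B C k x ∧
    ((1 + α) ^ k)⁻¹ * lamhat B C k x ≤ khat B C k x ∧
    khat B C k x ≤ lamhat B C k x := by
  clear hk
  have h0 : 0 < B := by linarith
  have ha : 0 < 1 + α := by linarith
  have hBC : B ≤ C := by
    rw [hC]
    exact Real.self_le_rpow_of_one_le hB.le (by linarith)
  have hL : 0 < Real.log B := Real.log_pos hB
  have hlogC : Real.log C = (1 + α) * Real.log B := by rw [hC, Real.log_rpow h0]
  have hupper : ∀ p ∈ Set.Icc B C, (Real.log p)⁻¹ ≤ (Real.log B)⁻¹ := fun p hp =>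
    inv_anti₀ hL (Real.log_le_log h0 hp.1)
  have hlower : ∀ p ∈ Set.Icc B C, (1 + α)⁻¹ * (Real.log B)⁻¹ ≤ (Real.log p)⁻¹ := by
    intro p hp
    rw [← mul_inv, ← hlogC]
    exact inv_anti₀ (Real.log_pos (hB.trans_le hp.1))
      (Real.log_le_log (h0.trans_le hp.1) hp.2)
  have hE : 0 ≤ 2 * Ehat B := mul_nonneg zero_le_two (Ehat_nonneg hB.le)
  have hE' : ∀ p ∈ Set.Icc B C, 0 ≤ deriv Ehat p := fun p hp =>
    deriv_Ehat_nonneg (hB.le.trans hp.1)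
  have cinv : ContinuousOn (fun p => (Real.log p)⁻¹) (Set.Icc B C) := continuousOn_inv_log hB
  have cE : ContinuousOn (deriv Ehat) (Set.Icc B C) := continuousOn_deriv_Ehat_Icc hB
  induction k generalizing x with
  | zero => simp [ktil, lamtil, khat, lamhat]
  | succ k ih =>
    obtain ⟨kt, kh⟩ := posMono_ktil_khat hB hBC k
    obtain ⟨lt, lh⟩ := posMono_lamtil_lamhat hB hBC k
    have hpos : ∀ p ∈ Set.Icc B C, 0 < x / p := fun p hp => div_pos hx (h0.trans_le hp.1)
    set c := ((1 + α) ^ k)⁻¹ with hc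
    have hc0 : 0 < c := by positivity
    have hcs : ((1 + α) ^ (k + 1))⁻¹ = c * (1 + α)⁻¹ := by rw [pow_succ, mul_inv]
    have hcle : c * (1 + α)⁻¹ ≤ c :=
      mul_le_of_le_one_right hc0.le (inv_le_one_of_one_le₀ (by linarith))
    have lowerStep : ∀ {f g : ℝ → ℝ}, PosMono f → PosMono g →
        (∀ y, 0 < y → c * f y ≤ g y) →
        c * (1 + α)⁻¹ * (∫ p in B..C, f (x / p) * (Real.log B)⁻¹) ≤
          ∫ p in B..C, g (x / p) * (Real.log p)⁻¹ := by
      intro f g hf hg hfg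
      refine integral_div_mono hf hg h0 hBC hx continuousOn_const cinv fun p hp => ?_
      calc c * (1 + α)⁻¹ * (f (x / p) * (Real.log B)⁻¹)
          = (c * f (x / p)) * ((1 + α)⁻¹ * (Real.log B)⁻¹) := by ring
        _ ≤ g (x / p) * (Real.log p)⁻¹ :=
          mul_le_mul (hfg _ (hpos p hp)) (hlower p hp) (by positivity) (hg.2 _ (hpos p hp))
    have upperStep : ∀ {f g : ℝ → ℝ}, PosMono f → PosMono g →
        (∀ y, 0 < y → f y ≤ g y) →
        (∫ p in B..C, f (x / p) * (Real.log p)⁻¹) ≤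
          ∫ p in B..C, g (x / p) * (Real.log B)⁻¹ := by
      intro f g hf hg hfg
      refine intervalIntegral.integral_mono_on hBC (hf.intervalIntegrable h0 hBC hx cinv)
        (hg.intervalIntegrable h0 hBC hx continuousOn_const) fun p hp => ?_
      exact mul_le_mul (hfg _ (hpos p hp)) (hupper p hp)
        (inv_nonneg.mpr (Real.log_nonneg (hB.le.trans hp.1))) (hg.2 _ (hpos p hp))
    have hsumL : ∀ y, 0 < y → c * (1 + α)⁻¹ * (lamtil B C k y + lamhat B C k y) ≤
        ktil B C k y + khat B C k y := by
      intro y hy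
      obtain ⟨i1, -, i3, -⟩ := ih y hy
      have := mul_le_mul_of_nonneg_right hcle ((lt.add lh).2 y hy)
      dsimp only at this
      linarith
    have hsumU : ∀ y, 0 < y → ktil B C k y + khat B C k y ≤
        lamtil B C k y + lamhat B C k y := fun y hy =>
      add_le_add (ih y hy).2.1 (ih y hy).2.2.2
    rw [hcs, ktil_succ, khat_succ, lamtil_succ, lamhat_succ]
    refine ⟨lowerStep lt kt fun y hy => (ih y hy).1, upperStep kt lt fun y hy => (ih y hy).2.1,
      ?_, ?_⟩
    · rw [mul_add, mul_add]
      refine add_le_add (add_le_add (lowerStep lh kh fun y hy => (ih y hy).2.2.1) ?_) ?_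
      · rw [← mul_assoc]
        exact mul_le_mul_of_nonneg_right (hsumL _ (div_pos hx h0)) hE
      · refine integral_div_mono (lt.add lh) (kt.add kh) h0 hBC hx cE cE fun p hp => ?_
        rw [← mul_assoc]
        exact mul_le_mul_of_nonneg_right (hsumL _ (hpos p hp)) (hE' p hp)
    · refine add_le_add (add_le_add (upperStep kh lh fun y hy => (ih y hy).2.2.2)
        (mul_le_mul_of_nonneg_right (hsumU _ (div_pos hx h0)) hE)) ?_
      exact intervalIntegral.integral_mono_on hBC
        ((kt.add kh).intervalIntegrable h0 hBC hx cE)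
        ((lt.add lh).intervalIntegrable h0 hBC hx cE) fun p hp =>
          mul_le_mul_of_nonneg_right (hsumU _ (hpos p hp)) (hE' p hp)
end

section
/- Let k ≥ 1 be an integer and j ∈ {0, 1, …, k−1}. Then for every ξ in the open interval (j, j+1), the (k−1)-st derivative of the polynomial hill m^k at ξ equals (−1)^j·binom(k−1, j) (for k = 1 this is the statement m^1(ξ) = 1 on (0,1)). -/
open MeasureTheory

/-- The polynomial hills `m^k`: `m^1` is the indicator of `[0,1)` and
`m^k(ξ) = ∫_{ξ-1}^{ξ} m^{k-1}(ρ) dρ` for `k ≥ 2`. (`hill 0` is junk.) -/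
noncomputable def hill : ℕ → ℝ → ℝ
  | 0 => fun _ => 0
  | 1 => fun ξ => if 0 ≤ ξ ∧ ξ < 1 then 1 else 0
  | k + 2 => fun ξ => ∫ ρ in (ξ - 1)..ξ, hill (k + 1) ρ

theorem hill_succ_eq_primitive_sub {n : ℕ}
    (hn : ∀ a b, IntervalIntegrable (hill (n + 1)) volume a b) : hill (n + 2) = fun x =>
      (∫ t in (0 : ℝ)..x, hill (n + 1) t) - ∫ t in (0 : ℝ)..(x - 1), hill (n + 1) t := by
  ext x
  rw [intervalIntegral.integral_interval_sub_left (hn _ _) (hn _ _), hill]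

theorem intervalIntegrable_hill (n : ℕ) (a b : ℝ) :
    IntervalIntegrable (hill (n + 1)) volume a b := by
  induction n generalizing a b with
  | zero =>
    have h : hill (0 + 1) = (Set.Ico (0 : ℝ) 1).indicator fun _ => 1 := by
      ext x
      simp [hill, Set.indicator_apply]
    rw [h]
    exact ⟨(intervalIntegrable_const (c := (1 : ℝ))).1.indicator measurableSet_Ico,
      (intervalIntegrable_const (c := (1 : ℝ))).2.indicator measurableSet_Ico⟩
  | succ n ih =>
    have hc := intervalIntegral.continuous_primitive ih 0
    rw [hill_succ_eq_primitive_sub ih]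
    exact (hc.sub (hc.comp (continuous_id.sub continuous_const))).intervalIntegrable a b

theorem isOpen_compl_range_intCast : IsOpen (Set.range ((↑) : ℤ → ℝ))ᶜ :=
  Int.isClosedEmbedding_coe_real.isClosed_range.isOpen_compl

theorem sub_one_mem_compl_range_intCast {x : ℝ} (hx : x ∈ (Set.range ((↑) : ℤ → ℝ))ᶜ) :
    x - 1 ∈ (Set.range ((↑) : ℤ → ℝ))ᶜ := by
  rintro ⟨m, hm⟩
  exact hx ⟨m + 1, by push_cast; linarith⟩

theorem hasDerivAt_hill_of_continuousOn {n : ℕ}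
    (hc : ContinuousOn (hill (n + 1)) (Set.range ((↑) : ℤ → ℝ))ᶜ) {x : ℝ}
    (hx : x ∈ (Set.range ((↑) : ℤ → ℝ))ᶜ) :
    HasDerivAt (hill (n + 2)) (hill (n + 1) x - hill (n + 1) (x - 1)) x := by
  have key : ∀ y ∈ (Set.range ((↑) : ℤ → ℝ))ᶜ,
      HasDerivAt (fun u => ∫ t in (0 : ℝ)..u, hill (n + 1) t) (hill (n + 1) y) y := fun y hy =>
    intervalIntegral.integral_hasDerivAt_right (intervalIntegrable_hill n _ _)
      (hc.stronglyMeasurableAtFilter isOpen_compl_range_intCast y hy)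
      (hc.continuousAt (isOpen_compl_range_intCast.mem_nhds hy))
  rw [hill_succ_eq_primitive_sub (intervalIntegrable_hill n)]
  exact (key x hx).sub ((key _ (sub_one_mem_compl_range_intCast hx)).comp_sub_const x 1)

theorem hill_one_eventuallyEq {x : ℝ} (hx : x ∈ (Set.range ((↑) : ℤ → ℝ))ᶜ) :
    hill 1 =ᶠ[nhds x] fun _ => hill 1 x := by
  have h0 : x ≠ 0 := fun h => hx ⟨0, by simp [h]⟩
  have h1 : x ≠ 1 := fun h => hx ⟨1, by simp [h]⟩
  rcases lt_or_gt_of_ne h0 with h | h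
  · filter_upwards [eventually_lt_nhds h] with y hy
    simp [hill, h.not_ge, hy.not_ge]
  rcases lt_or_gt_of_ne h1 with h' | h'
  · filter_upwards [eventually_gt_nhds h, eventually_lt_nhds h'] with y hy hy'
    simp [hill, h.le, hy.le, h', hy']
  · filter_upwards [eventually_gt_nhds h'] with y hy
    simp [hill, h'.not_gt, hy.not_gt]

open scoped ContDiff in
theorem contDiffOn_hill (n : ℕ) :
    ContDiffOn ℝ ∞ (hill (n + 1)) (Set.range ((↑) : ℤ → ℝ))ᶜ := by
  induction n with
  | zero =>
    exact fun x hx =>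
      (contDiffAt_const.congr_of_eventuallyEq (hill_one_eventuallyEq hx)).contDiffWithinAt
  | succ n ih =>
    have hd := fun x hx => hasDerivAt_hill_of_continuousOn ih.continuousOn (x := x) hx
    rw [contDiffOn_infty_iff_deriv_of_isOpen isOpen_compl_range_intCast]
    refine ⟨fun x hx => (hd x hx).differentiableAt.differentiableWithinAt, ?_⟩
    refine ContDiffOn.congr ?_ fun x hx => (hd x hx).deriv
    exact ih.sub (ih.comp (contDiff_id.sub contDiff_const).contDiffOn
      fun x hx => sub_one_mem_compl_range_intCast hx)

theorem iteratedDeriv_succ_hill (n : ℕ) {x : ℝ} (hx : x ∈ (Set.range ((↑) : ℤ → ℝ))ᶜ) :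
    iteratedDeriv (n + 1) (hill (n + 2)) x =
      iteratedDeriv n (hill (n + 1)) x - iteratedDeriv n (hill (n + 1)) (x - 1) := by
  have hsmooth : ∀ y ∈ (Set.range ((↑) : ℤ → ℝ))ᶜ, ContDiffAt ℝ n (hill (n + 1)) y :=
    fun y hy => ((contDiffOn_hill n).contDiffAt
      (isOpen_compl_range_intCast.mem_nhds hy)).of_le (mod_cast le_top)
  have hderiv : deriv (hill (n + 2)) =ᶠ[nhds x]
      fun y => hill (n + 1) y - hill (n + 1) (y - 1) := by
    filter_upwards [isOpen_compl_range_intCast.mem_nhds hx] with y hy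
    exact (hasDerivAt_hill_of_continuousOn (contDiffOn_hill n).continuousOn hy).deriv
  rw [iteratedDeriv_succ', hderiv.iteratedDeriv_eq, iteratedDeriv_fun_sub (hsmooth x hx),
    iteratedDeriv_comp_sub_const]
  exact (hsmooth _ (sub_one_mem_compl_range_intCast hx)).comp x
    (contDiffAt_id.sub contDiffAt_const)

theorem iteratedDeriv_hill_of_neg (n : ℕ) {x : ℝ} (hx : x ∈ (Set.range ((↑) : ℤ → ℝ))ᶜ)
    (hneg : x < 0) : iteratedDeriv n (hill (n + 1)) x = 0 := by
  induction n generalizing x with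
  | zero => simp [hill, hneg.not_ge]
  | succ n ih =>
    rw [iteratedDeriv_succ_hill n hx, ih hx hneg,
      ih (sub_one_mem_compl_range_intCast hx) (by linarith), sub_zero]

theorem mem_compl_range_intCast_of_lt_of_lt {m : ℤ} {x : ℝ} (h1 : (m : ℝ) < x)
    (h2 : x < m + 1) : x ∈ (Set.range ((↑) : ℤ → ℝ))ᶜ := by
  rintro ⟨l, rfl⟩
  norm_cast at h1 h2
  lia

theorem iteratedDeriv_hill (n j : ℕ) {x : ℝ} (h1 : (j : ℝ) < x) (h2 : x < j + 1) :
    iteratedDeriv n (hill (n + 1)) x = (-1) ^ j * (n.choose j : ℝ) := by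
  induction n generalizing x j with
  | zero =>
    cases j with
    | zero =>
      norm_num at h1 h2
      simp [hill, h1.le, h2]
    | succ j =>
      push_cast at h1
      have : ¬ x < 1 := by have := j.cast_nonneg (α := ℝ); linarith
      simp [hill, this]
  | succ n ih =>
    have hx : x ∈ (Set.range ((↑) : ℤ → ℝ))ᶜ :=
      mem_compl_range_intCast_of_lt_of_lt (m := j) (mod_cast h1) (mod_cast h2)
    rw [iteratedDeriv_succ_hill n hx, ih j h1 h2]
    cases j with
    | zero =>
      rw [iteratedDeriv_hill_of_neg n (sub_one_mem_compl_range_intCast hx)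
        (by norm_num at h2; linarith)]
      simp
    | succ j =>
      push_cast at h1 h2
      rw [ih j (by linarith) (by linarith), Nat.choose_succ_succ]
      push_cast
      ring

theorem hill_top_deriv (k : ℕ) (hk : 1 ≤ k) (j : ℕ) (hj : j < k)
    (ξ : ℝ) (h1 : (j : ℝ) < ξ) (h2 : ξ < (j : ℝ) + 1) :
    iteratedDeriv (k - 1) (hill k) ξ = (-1 : ℝ) ^ j * ((k - 1).choose j : ℝ) := by
  obtain ⟨n, rfl⟩ := Nat.exists_eq_add_of_le' hk
  exact iteratedDeriv_hill n j h1 h2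
end

section
/- Let k ≥ 2 be an integer and let ℓ be an integer with 0 ≤ ℓ ≤ k−2. Then for every real ξ ≥ 0, the ℓ-th derivative of the polynomial hill m^k at ξ equals (1/(k−1−ℓ)!)·Σ_{0 ≤ i ≤ ⌊ξ⌋} binom(k, i)·(−1)^i·(ξ − i)^{k−1−ℓ} (for ℓ = 0 the 0-th derivative is m^k itself). -/
open MeasureTheory

/-- The normalized truncated power `x ↦ x₊ⁿ / n!`, with value `1` at `x = 0` when `n = 0`. -/
noncomputable def truncPow (n : ℕ) (x : ℝ) : ℝ :=
  if 0 ≤ x then x ^ n / (n.factorial : ℝ) else 0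

lemma hasDerivAt_pow_div_factorial (n : ℕ) (x : ℝ) :
    HasDerivAt (fun y : ℝ => y ^ (n + 1) / ((n + 1).factorial : ℝ))
      (x ^ n / (n.factorial : ℝ)) x := by
  have h := (hasDerivAt_pow (n + 1) x).div_const ((n + 1).factorial : ℝ)
  have hval : ((n + 1 : ℕ) : ℝ) * x ^ (n + 1 - 1) / ((n + 1).factorial : ℝ) =
      x ^ n / (n.factorial : ℝ) := by
    have := Nat.factorial_ne_zero n
    rw [Nat.factorial_succ, Nat.add_sub_cancel]
    push_cast
    field_simp
  rwa [hval] at h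

lemma truncPow_monotone (n : ℕ) : Monotone (truncPow n) := by
  intro x y hxy
  unfold truncPow
  split_ifs with hx hy hy
  · gcongr
  · exact absurd (hx.trans hxy) hy
  · positivity
  · exact le_rfl

lemma continuous_truncPow_succ (n : ℕ) : Continuous (truncPow (n + 1)) := by
  have h : truncPow (n + 1) = fun x => (max x 0) ^ (n + 1) / ((n + 1).factorial : ℝ) := by
    funext x
    unfold truncPow
    split_ifs with hx
    · rw [max_eq_left hx]
    · rw [max_eq_right (not_le.mp hx).le]
      simp
  rw [h]
  fun_prop

lemma hasDerivWithinAt_Ici_truncPow (n : ℕ) {x : ℝ} (hx : 0 ≤ x) :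
    HasDerivWithinAt (truncPow (n + 1)) (truncPow n x) (Set.Ici x) x := by
  have h := (hasDerivAt_pow_div_factorial n x).hasDerivWithinAt (s := Set.Ici x)
  rw [truncPow, if_pos hx]
  exact h.congr (fun y hy => if_pos (hx.trans hy)) (if_pos hx)

lemma hasDerivAt_truncPow_of_neg (n : ℕ) {x : ℝ} (hx : x < 0) :
    HasDerivAt (truncPow (n + 1)) (truncPow n x) x := by
  rw [truncPow, if_neg (not_le.mpr hx)]
  refine (hasDerivAt_const x (0 : ℝ)).congr_of_eventuallyEq ?_
  filter_upwards [Iio_mem_nhds hx] with y hy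
  exact if_neg (not_le.mpr hy)

lemma hasDerivWithinAt_Ioi_truncPow (n : ℕ) (x : ℝ) :
    HasDerivWithinAt (truncPow (n + 1)) (truncPow n x) (Set.Ioi x) x := by
  rcases lt_or_ge x 0 with hx | hx
  · exact (hasDerivAt_truncPow_of_neg n hx).hasDerivWithinAt
  · exact (hasDerivWithinAt_Ici_truncPow n hx).mono Set.Ioi_subset_Ici_self

lemma hasDerivAt_truncPow (n : ℕ) (x : ℝ) :
    HasDerivAt (truncPow (n + 2)) (truncPow (n + 1) x) x := by
  rcases lt_trichotomy x 0 with hx | rfl | hx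
  · exact hasDerivAt_truncPow_of_neg _ hx
  · have hr := hasDerivWithinAt_Ici_truncPow (n + 1) (le_refl (0 : ℝ))
    have hl : HasDerivWithinAt (truncPow (n + 2)) (truncPow (n + 1) 0) (Set.Iic 0) 0 := by
      have h0 : truncPow (n + 1) 0 = 0 := by simp [truncPow]
      have hzero : ∀ y ∈ Set.Iic (0 : ℝ), truncPow (n + 2) y = 0 := by
        intro y hy
        unfold truncPow
        split_ifs with h
        · rw [le_antisymm hy h]
          simp
        · rfl
      rw [h0]
      exact (hasDerivWithinAt_const (0 : ℝ) _ (0 : ℝ)).congr hzero (hzero 0 Set.self_mem_Iic)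
    have h := hl.union hr
    rwa [Set.Iic_union_Ici, hasDerivWithinAt_univ] at h
  · rw [truncPow, if_pos hx.le]
    refine (hasDerivAt_pow_div_factorial (n + 1) x).congr_of_eventuallyEq ?_
    filter_upwards [Ioi_mem_nhds hx] with y hy
    exact if_pos (le_of_lt hy)

lemma integral_truncPow (n : ℕ) (a b : ℝ) :
    ∫ x in a..b, truncPow n x = truncPow (n + 1) b - truncPow (n + 1) a :=
  intervalIntegral.integral_eq_sub_of_hasDeriv_right (continuous_truncPow_succ n).continuousOn
    (fun x _ => hasDerivWithinAt_Ioi_truncPow n x) (truncPow_monotone n).intervalIntegrable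

lemma sum_choose_mul_sub_shift (n : ℕ) (P : ℝ → ℝ) (x : ℝ) :
    ∑ i ∈ Finset.range (n + 1), (n.choose i : ℝ) * (-1) ^ i * (P (x - i) - P (x - 1 - i)) =
      ∑ i ∈ Finset.range (n + 2), ((n + 1).choose i : ℝ) * (-1) ^ i * P (x - i) := by
  have h : ∑ i ∈ Finset.range (n + 1), (n.choose i : ℝ) * (-1) ^ i * P (x - i) =
      ∑ i ∈ Finset.range (n + 2), (n.choose i : ℝ) * (-1) ^ i * P (x - i) := by
    rw [Finset.sum_range_succ _ (n + 1)]
    simp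
  simp_rw [mul_sub]
  rw [Finset.sum_sub_distrib, h, Finset.sum_range_succ', Finset.sum_range_succ' _ (n + 1),
    add_sub_right_comm, ← Finset.sum_sub_distrib]
  congr 1
  · refine Finset.sum_congr rfl fun i _ => ?_
    rw [Nat.choose_succ_succ, show x - 1 - (i : ℝ) = x - ((i + 1 : ℕ) : ℝ) by push_cast; ring]
    push_cast
    ring
  · simp

lemma hill_succ_eq_sum_truncPow (n : ℕ) (x : ℝ) :
    hill (n + 1) x =
      ∑ i ∈ Finset.range (n + 2), ((n + 1).choose i : ℝ) * (-1) ^ i * truncPow n (x - i) := by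
  induction n generalizing x with
  | zero =>
    simp only [hill, truncPow, Finset.sum_range_succ, Finset.sum_range_zero]
    by_cases h0 : 0 ≤ x <;> by_cases h1 : x < 1
    · simp [h0, h1]
    · simp [h0, h1, not_lt.mp h1]
    · simp [h0, h1]
    · linarith
  | succ n ih =>
    have hint : ∀ i : ℕ, IntervalIntegrable
        (fun y => ((n + 1).choose i : ℝ) * (-1) ^ i * truncPow n (y - i)) volume (x - 1) x := by
      intro i
      refine IntervalIntegrable.const_mul ?_ _
      exact Monotone.intervalIntegrable fun a b hab =>
        truncPow_monotone n (sub_le_sub_right hab _)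
    have hstep : hill (n + 1 + 1) x = ∫ y in (x - 1)..x, hill (n + 1) y := by rw [hill]
    rw [hstep]
    simp_rw [ih]
    rw [intervalIntegral.integral_finsetSum fun i _ => hint i, ← sum_choose_mul_sub_shift]
    refine Finset.sum_congr rfl fun i _ => ?_
    rw [intervalIntegral.integral_const_mul,
      intervalIntegral.integral_comp_sub_right (truncPow n), integral_truncPow]

lemma iteratedDeriv_hill_s8 (m ℓ : ℕ) :
    iteratedDeriv ℓ (hill (m + ℓ + 2)) = fun x => ∑ i ∈ Finset.range (m + ℓ + 3),
      ((m + ℓ + 2).choose i : ℝ) * (-1) ^ i * truncPow (m + 1) (x - i) := by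
  induction ℓ generalizing m with
  | zero =>
    funext x
    rw [iteratedDeriv_zero]
    exact hill_succ_eq_sum_truncPow (m + 1) x
  | succ ℓ ih =>
    rw [iteratedDeriv_succ, show m + (ℓ + 1) = m + 1 + ℓ by omega, ih (m + 1)]
    funext x
    refine HasDerivAt.deriv (HasDerivAt.fun_sum fun i _ => HasDerivAt.const_mul _ ?_)
    exact (hasDerivAt_truncPow m (x - i)).comp_sub_const x (i : ℝ)

lemma sum_choose_truncPow_eq (k n : ℕ) {x : ℝ} (hx : 0 ≤ x) :
    ∑ i ∈ Finset.range (k + 1), (k.choose i : ℝ) * (-1) ^ i * truncPow n (x - i) =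
      (1 / (n.factorial : ℝ)) *
        ∑ i ∈ Finset.range (⌊x⌋₊ + 1), (k.choose i : ℝ) * (-1) ^ i * (x - i) ^ n := by
  have h1 : ∑ i ∈ Finset.range (k + 1), (k.choose i : ℝ) * (-1) ^ i * truncPow n (x - i) =
      ∑ i ∈ Finset.range (k + 1 + (⌊x⌋₊ + 1)),
        (k.choose i : ℝ) * (-1) ^ i * truncPow n (x - i) := by
    refine Finset.sum_subset (Finset.range_mono (by omega)) fun i _ hi => ?_
    rw [Finset.mem_range, not_lt] at hi
    simp [Nat.choose_eq_zero_of_lt (show k < i by omega)]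
  have h2 : ∑ i ∈ Finset.range (⌊x⌋₊ + 1), (k.choose i : ℝ) * (-1) ^ i * truncPow n (x - i) =
      ∑ i ∈ Finset.range (k + 1 + (⌊x⌋₊ + 1)),
        (k.choose i : ℝ) * (-1) ^ i * truncPow n (x - i) := by
    refine Finset.sum_subset (Finset.range_mono (by omega)) fun i _ hi => ?_
    rw [Finset.mem_range, not_lt] at hi
    have : x < i := (Nat.floor_lt hx).mp (by omega)
    rw [truncPow, if_neg (by linarith), mul_zero]
  rw [h1, ← h2, Finset.mul_sum]
  refine Finset.sum_congr rfl fun i hi => ?_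
  have : (i : ℝ) ≤ x := (Nat.le_floor_iff hx).mp (by rw [Finset.mem_range] at hi; omega)
  rw [truncPow, if_pos (by linarith)]
  ring

theorem hill_deriv_formula (k : ℕ) (hk : 2 ≤ k) (ℓ : ℕ) (hℓ : ℓ ≤ k - 2)
    (ξ : ℝ) (hξ : 0 ≤ ξ) :
    iteratedDeriv ℓ (hill k) ξ =
      (1 / (Nat.factorial (k - 1 - ℓ) : ℝ)) *
        ∑ i ∈ Finset.range (⌊ξ⌋₊ + 1),
          (k.choose i : ℝ) * (-1 : ℝ) ^ i * (ξ - (i : ℝ)) ^ (k - 1 - ℓ) := by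
  obtain ⟨m, rfl⟩ : ∃ m, k = m + ℓ + 2 := ⟨k - 2 - ℓ, by omega⟩
  rw [iteratedDeriv_hill_s8, show m + ℓ + 2 - 1 - ℓ = m + 1 by omega]
  exact sum_choose_truncPow_eq (m + ℓ + 2) (m + 1) hξ
end

section
/- Let k ≥ 2 be an integer, let B > 1 and α > 0 satisfy α·ln B ≥ (ln 16)/k, and let ξ ∈ [0, 1]. Then λ̃_norm^k(ξ) ≥ (exp(−(ln 4)²/(α·ln B))/(α·ln B))·ξ^k/k!. -/
open MeasureTheory

/-- The normalized function `λ̃_norm^k(ξ) = ∫_0^ξ B^{-ρα} m^k(ξ-ρ) dρ` (and `0` for `ξ < 0`). -/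
noncomputable def lamNorm (B α : ℝ) (k : ℕ) (ξ : ℝ) : ℝ :=
  if 0 ≤ ξ then ∫ ρ in (0:ℝ)..ξ, B ^ (-(ρ * α)) * hill k (ξ - ρ) else 0

/-- Below `1`, the hill `m^{n+1}` is the truncated power `x₊ⁿ / n!`. -/
theorem hill_succ_of_lt_one (n : ℕ) {x : ℝ} (hx : x < 1) :
    hill (n + 1) x = (Set.Ici (0:ℝ)).indicator (fun y => y ^ n / (n.factorial : ℝ)) x := by
  induction n generalizing x with
  | zero =>
    simp [hill, Set.indicator_apply, hx]
  | succ n ih =>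
    have hle : x - 1 ≤ x := by linarith
    have key : hill (n + 1 + 1) x
        = ∫ ρ in Set.Ioc (x - 1) x ∩ Set.Ici 0, ρ ^ n / (n.factorial : ℝ) := by
      change ∫ ρ in (x - 1)..x, hill (n + 1) ρ = _
      rw [intervalIntegral.integral_of_le hle, ← setIntegral_indicator measurableSet_Ici]
      refine setIntegral_congr_fun measurableSet_Ioc fun ρ hρ => ?_
      exact ih (lt_of_le_of_lt hρ.2 hx)
    rw [key]
    by_cases h0 : 0 ≤ x
    · have hset : Set.Ioc (x - 1) x ∩ Set.Ici 0 = Set.Icc 0 x := by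
        ext y
        simp only [Set.mem_inter_iff, Set.mem_Ioc, Set.mem_Ici, Set.mem_Icc]
        constructor
        · rintro ⟨⟨_, h2⟩, h3⟩
          exact ⟨h3, h2⟩
        · rintro ⟨h1, h2⟩
          exact ⟨⟨by linarith, h2⟩, h1⟩
      rw [hset, integral_Icc_eq_integral_Ioc, ← intervalIntegral.integral_of_le h0,
        intervalIntegral.integral_div, integral_pow, Set.indicator_of_mem (Set.mem_Ici.2 h0),
        Nat.factorial_succ]
      push_cast
      field_simp
      ring
    · have hset : Set.Ioc (x - 1) x ∩ Set.Ici 0 = ∅ := by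
        ext y
        simp only [Set.mem_inter_iff, Set.mem_Ioc, Set.mem_Ici, Set.mem_empty_iff_false, iff_false]
        rintro ⟨⟨_, h2⟩, h3⟩
        exact h0 (h3.trans h2)
      rw [hset, Measure.restrict_empty, integral_zero_measure,
        Set.indicator_of_notMem (by simpa using h0)]

/-- The Laplace-type integral `∫₀¹ e^{-ct} (1-t)ⁿ dt`. -/
noncomputable def expPowIntegral (n : ℕ) (c : ℝ) : ℝ :=
  ∫ t in (0:ℝ)..1, Real.exp (-(c * t)) * (1 - t) ^ n

theorem expPowIntegral_antitone (n : ℕ) : Antitone (expPowIntegral n) := by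
  intro a b hab
  refine intervalIntegral.integral_mono_on zero_le_one
    (Continuous.intervalIntegrable (by fun_prop) _ _)
    (Continuous.intervalIntegrable (by fun_prop) _ _) fun t ht => ?_
  have h1 : 0 ≤ 1 - t := sub_nonneg.2 ht.2
  have h2 : a * t ≤ b * t := mul_le_mul_of_nonneg_right hab ht.1
  gcongr

theorem integral_one_sub_pow (n : ℕ) : ∫ t in (0:ℝ)..1, (1 - t) ^ n = 1 / ((n : ℝ) + 1) := by
  rw [intervalIntegral.integral_comp_sub_left (fun t : ℝ => t ^ n) 1, integral_pow]
  simp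

/-- Jensen's inequality for the probability density `(n+1)(1-t)ⁿ` on `[0,1]`. -/
theorem exp_le_mul_expPowIntegral (n : ℕ) (c : ℝ) :
    Real.exp (-(c / ((n : ℝ) + 2))) ≤ ((n : ℝ) + 1) * expPowIntegral n c := by
  set m : ℝ := c / ((n : ℝ) + 2) with hm
  have hn1 : (0:ℝ) < (n : ℝ) + 1 := by positivity
  have hn2 : (0:ℝ) < (n : ℝ) + 2 := by positivity
  have hint : ∫ t in (0:ℝ)..1, Real.exp (-m) * ((1 - c + m) * (1 - t) ^ n + c * (1 - t) ^ (n + 1))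
      = Real.exp (-m) / ((n : ℝ) + 1) := by
    rw [intervalIntegral.integral_const_mul, intervalIntegral.integral_add
      (Continuous.intervalIntegrable (by fun_prop) _ _)
      (Continuous.intervalIntegrable (by fun_prop) _ _), intervalIntegral.integral_const_mul,
      intervalIntegral.integral_const_mul, integral_one_sub_pow, integral_one_sub_pow, hm]
    push_cast
    have hn3 : (n : ℝ) + 1 + 1 = (n : ℝ) + 2 := by ring
    rw [hn3]
    field_simp
    ring
  have hmono : Real.exp (-m) / ((n : ℝ) + 1) ≤ expPowIntegral n c := by
    rw [← hint]
    refine intervalIntegral.integral_mono_on zero_le_one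
      (Continuous.intervalIntegrable (by fun_prop) _ _)
      (Continuous.intervalIntegrable (by fun_prop) _ _) fun t ht => ?_
    have h1 : 0 ≤ 1 - t := sub_nonneg.2 ht.2
    have h2 : m - c * t + 1 ≤ Real.exp (m - c * t) := Real.add_one_le_exp _
    have h3 : Real.exp (-(c * t)) = Real.exp (-m) * Real.exp (m - c * t) := by
      rw [← Real.exp_add]
      congr 1
      ring
    calc Real.exp (-m) * ((1 - c + m) * (1 - t) ^ n + c * (1 - t) ^ (n + 1))
        = Real.exp (-m) * (m - c * t + 1) * (1 - t) ^ n := by ring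
      _ ≤ Real.exp (-m) * Real.exp (m - c * t) * (1 - t) ^ n := by gcongr
      _ = Real.exp (-(c * t)) * (1 - t) ^ n := by rw [h3]
  rw [div_le_iff₀ hn1] at hmono
  linarith

theorem mul_expPowIntegral (n : ℕ) {c : ℝ} (hc : 0 < c) :
    c * expPowIntegral n c = ∫ s in (0:ℝ)..c, Real.exp (-s) * (1 - s / c) ^ n := by
  have h := intervalIntegral.mul_integral_comp_mul_left (a := 0) (b := 1)
    (f := fun s : ℝ => Real.exp (-s) * (1 - s / c) ^ n) (c := c)
  rw [mul_zero, mul_one] at h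
  rw [← h, expPowIntegral]
  simp only [mul_div_cancel_left₀ _ hc.ne']

theorem mul_expPowIntegral_mono (n : ℕ) {a c : ℝ} (ha : 0 < a) (hac : a ≤ c) :
    a * expPowIntegral n a ≤ c * expPowIntegral n c := by
  have hc : 0 < c := ha.trans_le hac
  rw [mul_expPowIntegral n ha, mul_expPowIntegral n hc]
  have hcont : Continuous fun s : ℝ => Real.exp (-s) * (1 - s / c) ^ n := by fun_prop
  rw [← intervalIntegral.integral_add_adjacent_intervals
    (hcont.intervalIntegrable 0 a) (hcont.intervalIntegrable a c)]
  have h1 : ∫ s in (0:ℝ)..a, Real.exp (-s) * (1 - s / a) ^ n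
      ≤ ∫ s in (0:ℝ)..a, Real.exp (-s) * (1 - s / c) ^ n := by
    refine intervalIntegral.integral_mono_on ha.le
      (Continuous.intervalIntegrable (by fun_prop) _ _)
      (hcont.intervalIntegrable _ _) fun s hs => ?_
    have h2 : 0 ≤ 1 - s / a := sub_nonneg.2 ((div_le_one ha).2 hs.2)
    have h3 : s / c ≤ s / a := div_le_div_of_nonneg_left hs.1 ha hac
    gcongr
  have h4 : 0 ≤ ∫ s in a..c, Real.exp (-s) * (1 - s / c) ^ n := by
    refine intervalIntegral.integral_nonneg hac fun s hs => ?_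
    have h5 : 0 ≤ 1 - s / c := sub_nonneg.2 ((div_le_one hc).2 hs.2)
    positivity
  linarith

theorem exp_div_le_mul_expPowIntegral {n : ℕ} (hn : 1 ≤ n) {c A : ℝ} (hc : 0 < c) (hA : 1 ≤ A) :
    Real.exp (-A / c) / c ≤ ((n : ℝ) + 1) * expPowIntegral n c := by
  have hn' : (1:ℝ) ≤ n := by exact_mod_cast hn
  have hn2 : (0:ℝ) < (n : ℝ) + 2 := by positivity
  rcases le_total c ((n : ℝ) + 2) with h | h
  · refine le_trans ?_ (exp_le_mul_expPowIntegral n c)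
    have h1 : Real.exp (-1) ≤ Real.exp (-(c / ((n : ℝ) + 2))) :=
      Real.exp_le_exp.2 (neg_le_neg ((div_le_one hn2).2 h))
    refine le_trans ?_ h1
    have h2 : A / c ≤ Real.exp (A / c - 1) := by
      have := Real.add_one_le_exp (A / c - 1)
      linarith
    have h3 : 1 / c ≤ Real.exp (A / c - 1) := le_trans (by gcongr) h2
    calc Real.exp (-A / c) / c = Real.exp (-A / c) * (1 / c) := by ring
      _ ≤ Real.exp (-A / c) * Real.exp (A / c - 1) := by gcongr
      _ = Real.exp (-1) := by
        rw [← Real.exp_add]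
        congr 1
        ring
  · have h1 := exp_le_mul_expPowIntegral n ((n : ℝ) + 2)
    rw [div_self hn2.ne'] at h1
    have h2 := mul_expPowIntegral_mono n hn2 h
    have h3 : (1:ℝ) ≤ ((n : ℝ) + 2) * Real.exp (-1) := by
      rw [Real.exp_neg, ← div_eq_mul_inv, le_div_iff₀ (Real.exp_pos 1)]
      linarith [Real.exp_one_lt_d9]
    have h4 : Real.exp (-A / c) ≤ 1 :=
      Real.exp_le_one_iff.2 (div_nonpos_of_nonpos_of_nonneg (by linarith) hc.le)
    rw [div_le_iff₀ hc]
    calc Real.exp (-A / c) ≤ 1 := h4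
      _ ≤ ((n : ℝ) + 2) * Real.exp (-1) := h3
      _ ≤ ((n : ℝ) + 2) * (((n : ℝ) + 1) * expPowIntegral n ((n : ℝ) + 2)) := by gcongr
      _ = ((n : ℝ) + 1) * (((n : ℝ) + 2) * expPowIntegral n ((n : ℝ) + 2)) := by ring
      _ ≤ ((n : ℝ) + 1) * (c * expPowIntegral n c) := by gcongr
      _ = ((n : ℝ) + 1) * expPowIntegral n c * c := by ring

theorem lamNorm_succ_eq {B : ℝ} (hB : 0 < B) (α : ℝ) (n : ℕ) {ξ : ℝ}
    (hξ : ξ ∈ Set.Icc (0:ℝ) 1) :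
    lamNorm B α (n + 1) ξ
      = ξ ^ (n + 1) / (n.factorial : ℝ) * expPowIntegral n (α * Real.log B * ξ) := by
  have hcongr : lamNorm B α (n + 1) ξ = ∫ ρ in (0:ℝ)..ξ,
      Real.exp (-(α * Real.log B * ρ)) * ((ξ - ρ) ^ n / (n.factorial : ℝ)) := by
    rw [lamNorm, if_pos hξ.1, intervalIntegral.integral_of_le hξ.1,
      intervalIntegral.integral_of_le hξ.1]
    refine setIntegral_congr_fun measurableSet_Ioc fun ρ hρ => ?_
    have h1 : ξ - ρ < 1 := by linarith [hρ.1, hξ.2]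
    have h2 : 0 ≤ ξ - ρ := sub_nonneg.2 hρ.2
    rw [hill_succ_of_lt_one n h1, Set.indicator_of_mem (Set.mem_Ici.2 h2),
      Real.rpow_def_of_pos hB]
    congr 2
    ring
  have hsub := intervalIntegral.mul_integral_comp_mul_left (a := 0) (b := 1) (c := ξ)
    (f := fun ρ : ℝ => Real.exp (-(α * Real.log B * ρ)) * ((ξ - ρ) ^ n / (n.factorial : ℝ)))
  rw [mul_zero, mul_one] at hsub
  rw [hcongr, ← hsub, expPowIntegral, ← intervalIntegral.integral_const_mul,
    ← intervalIntegral.integral_const_mul]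
  congr 1
  ext t
  have h3 : ξ - ξ * t = ξ * (1 - t) := by ring
  rw [h3, mul_pow, mul_assoc (α * Real.log B)]
  ring

theorem lamNorm_lower_left (B α : ℝ) (hB : 1 < B) (hα : 0 < α) (k : ℕ) (hk : 2 ≤ k)
    (hcond : Real.log 16 / (k : ℝ) ≤ α * Real.log B) (ξ : ℝ) (hξ : ξ ∈ Set.Icc (0:ℝ) 1) :
    Real.exp (-(Real.log 4) ^ 2 / (α * Real.log B)) / (α * Real.log B)
        * (ξ ^ k / (Nat.factorial k : ℝ)) ≤
      lamNorm B α k ξ := by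
  obtain ⟨n, rfl⟩ : ∃ n, k = n + 1 := ⟨k - 1, by omega⟩
  have hc : 0 < α * Real.log B := mul_pos hα (Real.log_pos hB)
  have hlog : 1 ≤ Real.log 4 := by
    rw [Real.le_log_iff_exp_le (by norm_num)]
    linarith [Real.exp_one_lt_d9]
  have hsq : 1 ≤ Real.log 4 ^ 2 := one_le_pow₀ hlog
  have hmain := exp_div_le_mul_expPowIntegral (n := n) (by omega) hc hsq
  have hanti : expPowIntegral n (α * Real.log B) ≤ expPowIntegral n (α * Real.log B * ξ) :=
    expPowIntegral_antitone n (mul_le_of_le_one_right hc.le hξ.2)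
  have hξ0 := hξ.1
  rw [lamNorm_succ_eq (by linarith) α n hξ]
  calc Real.exp (-(Real.log 4) ^ 2 / (α * Real.log B)) / (α * Real.log B)
        * (ξ ^ (n + 1) / ((n + 1).factorial : ℝ))
      ≤ ((n : ℝ) + 1) * expPowIntegral n (α * Real.log B * ξ)
        * (ξ ^ (n + 1) / ((n + 1).factorial : ℝ)) := by
        refine mul_le_mul_of_nonneg_right (hmain.trans ?_) (by positivity)
        gcongr
    _ = ξ ^ (n + 1) / (n.factorial : ℝ) * expPowIntegral n (α * Real.log B * ξ) := by
        rw [Nat.factorial_succ]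
        push_cast
        field_simp
end

section
/- For every integer k ≥ 3 and every real τ > 0, Σ_{0 ≤ ℓ ≤ k−2} τ^ℓ/ℓ! ≥ (1 − (1 − e^{−τ})^k)·(e^τ − τ^{k−1}/(k−1)!). -/
open MeasureTheory

open Filter Topology

theorem hasSum_exp_sub_sum_range (x : ℝ) (n : ℕ) :
    HasSum (fun j : ℕ => x ^ (j + n) / (Nat.factorial (j + n) : ℝ))
      (Real.exp x - ∑ ℓ ∈ Finset.range n, x ^ ℓ / (Nat.factorial ℓ : ℝ)) := by
  have h : HasSum (fun j : ℕ => x ^ j / (Nat.factorial j : ℝ)) (Real.exp x) := by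
    rw [Real.exp_eq_exp_ℝ]
    exact NormedSpace.expSeries_div_hasSum_exp x
  exact (hasSum_nat_add_iff' (f := fun j : ℕ => x ^ j / (Nat.factorial j : ℝ)) n).2 h

theorem sum_range_lt_exp {x : ℝ} (hx : 0 < x) (n : ℕ) :
    ∑ ℓ ∈ Finset.range n, x ^ ℓ / (Nat.factorial ℓ : ℝ) < Real.exp x := by
  have h := hasSum_exp_sub_sum_range x n
  have h0 := h.summable.tsum_pos (fun j => by positivity) 0 (by positivity)
  rw [h.tsum_eq] at h0
  linarith

theorem mul_exp_sub_sum_range_le {x : ℝ} (hx : 0 ≤ x) (n i : ℕ)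
    (hfac : ∀ j : ℕ, (n + i) * (Nat.factorial n * Nat.factorial (j + i)) ≤
      Nat.factorial (j + (n + i))) :
    ((n + i : ℕ) : ℝ) *
        (Real.exp x - ∑ ℓ ∈ Finset.range (n + i), x ^ ℓ / (Nat.factorial ℓ : ℝ)) ≤
      x ^ n / (Nat.factorial n : ℝ) *
        (Real.exp x - ∑ ℓ ∈ Finset.range i, x ^ ℓ / (Nat.factorial ℓ : ℝ)) := by
  refine hasSum_le (fun j => ?_) ((hasSum_exp_sub_sum_range x (n + i)).mul_left _)
    ((hasSum_exp_sub_sum_range x i).mul_left _)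
  have h : (((n + i : ℕ) : ℝ)) * (Nat.factorial n * Nat.factorial (j + i)) ≤
      Nat.factorial (j + (n + i)) := mod_cast hfac j
  have hpow : x ^ n * x ^ (j + i) = x ^ (j + (n + i)) := by ring
  rw [div_mul_div_comm, hpow, ← mul_div_assoc, div_le_div_iff₀ (by positivity) (by positivity)]
  nlinarith [mul_le_mul_of_nonneg_left h (pow_nonneg hx (j + (n + i)))]

theorem add_one_mul_factorial_mul_factorial_le (n j : ℕ) :
    (n + 1) * (Nat.factorial n * Nat.factorial (j + 1)) ≤ Nat.factorial (j + (n + 1)) := by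
  induction j with
  | zero => simp [Nat.factorial_succ]
  | succ j ih =>
    rw [Nat.factorial_succ (j + 1), show j + 1 + (n + 1) = (j + (n + 1)) + 1 by ring,
      Nat.factorial_succ (j + (n + 1))]
    calc _ = (j + 1 + 1) * ((n + 1) * (Nat.factorial n * Nat.factorial (j + 1))) := by ring
      _ ≤ _ := Nat.mul_le_mul (by omega) ih

theorem add_two_mul_factorial_mul_factorial_le {n : ℕ} (hn : 1 ≤ n) (j : ℕ) :
    (n + 2) * (Nat.factorial n * Nat.factorial (j + 2)) ≤ Nat.factorial (j + (n + 2)) := by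
  induction j with
  | zero =>
    simp only [zero_add, Nat.factorial_succ, Nat.factorial_zero]
    nlinarith [Nat.mul_le_mul_left ((n + 2) * Nat.factorial n) hn]
  | succ j ih =>
    rw [show j + 1 + 2 = (j + 2) + 1 by ring, Nat.factorial_succ (j + 2),
      show j + 1 + (n + 2) = (j + (n + 2)) + 1 by ring, Nat.factorial_succ (j + (n + 2))]
    calc _ = (j + 2 + 1) * ((n + 2) * (Nat.factorial n * Nat.factorial (j + 2))) := by ring
      _ ≤ _ := Nat.mul_le_mul (by omega) ih

theorem hasDerivAt_pow_succ_div_factorial (n : ℕ) (x : ℝ) :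
    HasDerivAt (fun y : ℝ => y ^ (n + 1) / (Nat.factorial (n + 1) : ℝ))
      (x ^ n / (Nat.factorial n : ℝ)) x := by
  refine ((hasDerivAt_pow (n + 1) x).div_const _).congr_deriv ?_
  rw [Nat.factorial_succ]
  push_cast
  field_simp

theorem hasDerivAt_sum_range_succ (n : ℕ) (x : ℝ) :
    HasDerivAt (fun y : ℝ => ∑ ℓ ∈ Finset.range (n + 1), y ^ ℓ / (Nat.factorial ℓ : ℝ))
      (∑ ℓ ∈ Finset.range n, x ^ ℓ / (Nat.factorial ℓ : ℝ)) x := by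
  simp only [Finset.sum_range_succ', pow_zero]
  exact (HasDerivAt.fun_sum fun i _ => hasDerivAt_pow_succ_div_factorial i x).add_const _

theorem tendsto_pow_div_factorial_mul_exp_neg (n : ℕ) :
    Tendsto (fun x : ℝ => x ^ n / (Nat.factorial n : ℝ) * Real.exp (-x)) atTop (𝓝 0) := by
  have h := (Real.tendsto_pow_mul_exp_neg_atTop_nhds_zero n).div_const (Nat.factorial n : ℝ)
  rw [zero_div] at h
  exact h.congr fun x => by ring

/-- With `N` Poisson of mean `x`, this is the logarithm of
`P(N ≥ n + 2 ∣ N ≠ n + 1) / P(N ≥ 1) ^ (n + 2)`. -/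
noncomputable def logTailRatio (n : ℕ) (x : ℝ) : ℝ :=
  Real.log (1 - (∑ ℓ ∈ Finset.range (n + 2), x ^ ℓ / (Nat.factorial ℓ : ℝ)) * Real.exp (-x)) -
    Real.log (1 - x ^ (n + 1) / (Nat.factorial (n + 1) : ℝ) * Real.exp (-x)) -
    ((n + 2 : ℕ) : ℝ) * Real.log (1 - Real.exp (-x))

theorem tendsto_logTailRatio (n : ℕ) : Tendsto (logTailRatio n) atTop (𝓝 0) := by
  have hlog {f : ℝ → ℝ} (hf : Tendsto f atTop (𝓝 0)) :
      Tendsto (fun x => Real.log (1 - f x)) atTop (𝓝 0) := by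
    have h : Tendsto (fun x => 1 - f x) atTop (𝓝 1) := by simpa using hf.const_sub 1
    simpa using h.log one_ne_zero
  have hsum : Tendsto (fun x : ℝ => (∑ ℓ ∈ Finset.range (n + 2), x ^ ℓ / (Nat.factorial ℓ : ℝ)) *
      Real.exp (-x)) atTop (𝓝 0) := by
    simp only [Finset.sum_mul]
    simpa using tendsto_finsetSum (Finset.range (n + 2))
      fun ℓ _ => tendsto_pow_div_factorial_mul_exp_neg ℓ
  have h := ((hlog hsum).sub (hlog (tendsto_pow_div_factorial_mul_exp_neg (n + 1)))).sub
    ((hlog Real.tendsto_exp_neg_atTop_nhds_zero).const_mul ((n + 2 : ℕ) : ℝ))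
  simp only [sub_zero, mul_zero] at h
  exact h

theorem one_sub_mul_exp_neg_pos {x a : ℝ} (h : a < Real.exp x) : 0 < 1 - a * Real.exp (-x) := by
  rw [Real.exp_neg, sub_pos, ← div_eq_mul_inv, div_lt_one (Real.exp_pos x)]
  exact h

theorem pow_div_factorial_lt_exp {x : ℝ} (hx : 0 < x) (n : ℕ) :
    x ^ n / (Nat.factorial n : ℝ) < Real.exp x :=
  (Finset.single_le_sum (f := fun ℓ : ℕ => x ^ ℓ / (Nat.factorial ℓ : ℝ))
    (fun ℓ _ => by positivity) (Finset.self_mem_range_succ n)).trans_lt (sum_range_lt_exp hx _)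

theorem monotoneOn_logTailRatio {n : ℕ} (hn : 1 ≤ n) :
    MonotoneOn (logTailRatio n) (Set.Ioi 0) := by
  have key (x : ℝ) (hx : 0 < x) : ∃ d, 0 ≤ d ∧ HasDerivAt (logTailRatio n) d x := by
    have hB := one_sub_mul_exp_neg_pos (sum_range_lt_exp hx (n + 2))
    have hC := one_sub_mul_exp_neg_pos (pow_div_factorial_lt_exp hx (n + 1))
    have hq : 0 < 1 - Real.exp (-x) := by
      simpa using one_sub_mul_exp_neg_pos (Real.one_lt_exp_iff.2 hx)
    have hE : HasDerivAt (fun y : ℝ => Real.exp (-y)) (-Real.exp (-x)) x := by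
      simpa using (hasDerivAt_neg x).exp
    have hderiv := (((((hasDerivAt_sum_range_succ (n + 1) x).mul hE).const_sub 1).log hB.ne').sub
      ((((hasDerivAt_pow_succ_div_factorial n x).mul hE).const_sub 1).log hC.ne')).sub
      (((hE.const_sub 1).log hq.ne').const_mul ((n + 2 : ℕ) : ℝ))
    refine ⟨_, ?_, hderiv⟩
    have h1 := mul_exp_sub_sum_range_le hx.le (n + 1) 1
      (add_one_mul_factorial_mul_factorial_le (n + 1))
    have h2 := mul_exp_sub_sum_range_le hx.le n 2 (add_two_mul_factorial_mul_factorial_le hn)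
    have hs : 0 < x ^ n / (Nat.factorial n : ℝ) := by positivity
    have ha : 0 ≤ ∑ ℓ ∈ Finset.range (n + 1), x ^ ℓ / (Nat.factorial ℓ : ℝ) :=
      Finset.sum_nonneg fun ℓ _ => by positivity
    have hb := sum_range_lt_exp hx (n + 2)
    have hab := pow_div_factorial_lt_exp hx (n + 1)
    have he := Real.one_lt_exp_iff.2 hx
    simp only [Pi.mul_apply] at hB hC ⊢
    simp only [show n + 1 + 1 = n + 2 from rfl] at h1 ⊢
    rw [Finset.sum_range_succ _ (n + 1)] at h1 h2 hb hB ⊢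
    simp only [Finset.sum_range_succ _ 1, Finset.sum_range_one, Nat.factorial_zero, pow_zero,
      pow_one, Nat.factorial_one, Nat.cast_one, div_one] at h1 h2
    rw [Real.exp_neg] at hB hC hq ⊢
    generalize (∑ ℓ ∈ Finset.range (n + 1), x ^ ℓ / (Nat.factorial ℓ : ℝ)) = a at *
    generalize x ^ (n + 1) / (Nat.factorial (n + 1) : ℝ) = t at *
    generalize x ^ n / (Nat.factorial n : ℝ) = s at *
    generalize Real.exp x = e at *
    generalize ((n + 2 : ℕ) : ℝ) = k at *
    have he0 : 0 < e := by linarith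
    have hb' : 0 < e - (a + t) := by linarith
    have hab' : 0 < e - t := by linarith
    have he' : 0 < e - 1 := by linarith
    have h2' : k * (e - (a + t)) ≤ s * (e - 1) := by nlinarith
    have hmain : 0 ≤ (t * a + (e - (a + t)) * s) * (e - 1) - k * (e - (a + t)) * (e - t) := by
      nlinarith [mul_le_mul_of_nonneg_right h1 ha, mul_le_mul_of_nonneg_right h2' hb'.le]
    have heq : -(a * e⁻¹ + (a + t) * -e⁻¹) / (1 - (a + t) * e⁻¹) -
        -(s * e⁻¹ + t * -e⁻¹) / (1 - t * e⁻¹) - k * (- -e⁻¹ / (1 - e⁻¹)) =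
        ((t * a + (e - (a + t)) * s) * (e - 1) - k * (e - (a + t)) * (e - t)) /
          ((e - (a + t)) * (e - t) * (e - 1)) := by
      have e1 : 1 - (a + t) * e⁻¹ = (e - (a + t)) / e := by field_simp
      have e2 : 1 - t * e⁻¹ = (e - t) / e := by field_simp
      have e3 : 1 - e⁻¹ = (e - 1) / e := by field_simp
      rw [e1, e2, e3]
      have := hb'.ne'
      have := hab'.ne'
      have := he'.ne'
      field_simp
      ring
    rw [heq]
    positivity
  choose! d hd hderiv using key
  refine monotoneOn_of_deriv_nonneg (convex_Ioi 0)
    (fun x hx => (hderiv x hx).continuousAt.continuousWithinAt) ?_ ?_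
  · rw [interior_Ioi]
    exact fun x hx => (hderiv x hx).differentiableAt.differentiableWithinAt
  · rw [interior_Ioi]
    exact fun x hx => (hderiv x hx).deriv ▸ hd x hx

theorem logTailRatio_nonpos {n : ℕ} (hn : 1 ≤ n) {x : ℝ} (hx : 0 < x) : logTailRatio n x ≤ 0 :=
  ge_of_tendsto (tendsto_logTailRatio n) <| (eventually_ge_atTop x).mono fun _ hy =>
    monotoneOn_logTailRatio hn hx (hx.trans_le hy) hy

theorem exp_partial_sum_ineq (k : ℕ) (hk : 3 ≤ k) (τ : ℝ) (hτ : 0 < τ) :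
    (1 - (1 - Real.exp (-τ)) ^ k) * (Real.exp τ - τ ^ (k - 1) / (Nat.factorial (k - 1) : ℝ)) ≤
      ∑ ℓ ∈ Finset.range (k - 1), τ ^ ℓ / (Nat.factorial ℓ : ℝ) := by
  obtain ⟨n, rfl⟩ := Nat.exists_eq_add_of_le' (show 2 ≤ k by omega)
  rw [show n + 2 - 1 = n + 1 from rfl]
  have h := logTailRatio_nonpos (show 1 ≤ n by omega) hτ
  have hB := one_sub_mul_exp_neg_pos (sum_range_lt_exp hτ (n + 2))
  have hC := one_sub_mul_exp_neg_pos (pow_div_factorial_lt_exp hτ (n + 1))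
  have hq : 0 < 1 - Real.exp (-τ) := by
    simpa using one_sub_mul_exp_neg_pos (Real.one_lt_exp_iff.2 hτ)
  rw [logTailRatio, ← Real.log_pow, sub_sub, sub_nonpos,
    ← Real.log_mul hC.ne' (pow_pos hq _).ne', Real.log_le_log_iff hB (by positivity)] at h
  have h' := mul_le_mul_of_nonneg_left h (Real.exp_pos τ).le
  rw [Finset.sum_range_succ] at h'
  have hee : Real.exp τ * Real.exp (-τ) = 1 := by rw [← Real.exp_add]; simp
  have hmul (y : ℝ) : Real.exp τ * (1 - y * Real.exp (-τ)) = Real.exp τ - y := by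
    linear_combination (-y) * hee
  rw [← mul_assoc, hmul, hmul] at h'
  linarith
end

section
/- Let B > 1, α > 0 and k ≥ 1 an integer. Then λ̃_norm^k(ξ) ≤ 1/(α·ln B) for all real ξ. Moreover, assume α·ln B ≥ max(ln 2, (ln 16)/k), let ε ∈ (0, 1], and assume that either k ≤ 2, or that ε ≤ k − ξ_½ for some ξ_½ ∈ (0, k] such that λ̃_norm^k is monotone increasing on (0, ξ_½) and monotone decreasing on (ξ_½, k). Then for all ξ ∈ [ε, k−ε], λ̃_norm^k(ξ) ≥ č_k/(α·ln B), where č_k = min(2^{−4}·ε^k/k!, 2^{−k}·ε^{k−1}/(k−1)!). -/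
open MeasureTheory

lemma hill_one (ξ : ℝ) : hill 1 ξ = if 0 ≤ ξ ∧ ξ < 1 then 1 else 0 := by
  simp only [hill]

lemma hill_succ_succ (k : ℕ) (ξ : ℝ) :
    hill (k + 2) ξ = ∫ ρ in (ξ - 1)..ξ, hill (k + 1) ρ := by
  simp only [hill]

lemma hill_one_intervalIntegrable (a b : ℝ) : IntervalIntegrable (hill 1) volume a b := by
  have h : hill 1 = (Set.Ico (0 : ℝ) 1).indicator fun _ => (1 : ℝ) := by
    funext ξ
    simp [hill_one, Set.indicator_apply]
  rw [h]
  refine Integrable.intervalIntegrable ?_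
  rw [integrable_indicator_iff measurableSet_Ico]
  exact integrableOn_const (by simp)

lemma continuous_integral_sub_one {f : ℝ → ℝ} (hf : ∀ a b, IntervalIntegrable f volume a b) :
    Continuous fun ξ : ℝ => ∫ ρ in (ξ - 1)..ξ, f ρ := by
  have h : (fun ξ : ℝ => ∫ ρ in (ξ - 1)..ξ, f ρ)
      = fun ξ => (∫ ρ in (0 : ℝ)..ξ, f ρ) - ∫ ρ in (0 : ℝ)..(ξ - 1), f ρ := by
    funext ξ
    rw [intervalIntegral.integral_interval_sub_left (hf _ _) (hf _ _)]
  rw [h]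
  have hc := intervalIntegral.continuous_primitive hf 0
  exact hc.sub (hc.comp (continuous_id.sub continuous_const))

lemma hill_intervalIntegrable (k : ℕ) (a b : ℝ) :
    IntervalIntegrable (hill (k + 1)) volume a b := by
  induction k generalizing a b with
  | zero => exact hill_one_intervalIntegrable a b
  | succ k ih =>
    have h : hill (k + 1 + 1) = fun ξ => ∫ ρ in (ξ - 1)..ξ, hill (k + 1) ρ :=
      funext (hill_succ_succ k)
    rw [h]
    exact (continuous_integral_sub_one ih).intervalIntegrable a b

lemma hill_nonneg (k : ℕ) (ξ : ℝ) : 0 ≤ hill (k + 1) ξ := by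
  induction k generalizing ξ with
  | zero => rw [hill_one]; split_ifs <;> norm_num
  | succ k ih =>
    rw [hill_succ_succ]
    exact intervalIntegral.integral_nonneg (by linarith) fun ρ _ => ih ρ

lemma hill_le_one (k : ℕ) (ξ : ℝ) : hill (k + 1) ξ ≤ 1 := by
  induction k generalizing ξ with
  | zero => rw [hill_one]; split_ifs <;> norm_num
  | succ k ih =>
    rw [hill_succ_succ]
    calc ∫ ρ in (ξ - 1)..ξ, hill (k + 1) ρ
        ≤ ∫ _ in (ξ - 1)..ξ, (1 : ℝ) :=
          intervalIntegral.integral_mono_on (by linarith) (hill_intervalIntegrable k _ _)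
            intervalIntegrable_const fun ρ _ => ih ρ
      _ = 1 := by simp

lemma integral_pow_div_factorial (k : ℕ) (x : ℝ) :
    ∫ ρ in (0 : ℝ)..x, ρ ^ k / (Nat.factorial k : ℝ)
      = x ^ (k + 1) / (Nat.factorial (k + 1) : ℝ) := by
  rw [intervalIntegral.integral_div, integral_pow, Nat.factorial_succ]
  push_cast
  have h1 : (Nat.factorial k : ℝ) ≠ 0 := by positivity
  have h2 : (k : ℝ) + 1 ≠ 0 := by positivity
  simp only [zero_pow (Nat.succ_ne_zero k), sub_zero]
  field_simp

lemma pow_div_factorial_le_hill (k : ℕ) {ξ : ℝ} (h0 : 0 ≤ ξ) (h1 : ξ < 1) :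
    ξ ^ k / (Nat.factorial k : ℝ) ≤ hill (k + 1) ξ := by
  induction k generalizing ξ with
  | zero => rw [hill_one, if_pos ⟨h0, h1⟩]; simp
  | succ k ih =>
    rw [hill_succ_succ, ← integral_pow_div_factorial]
    calc ∫ ρ in (0 : ℝ)..ξ, ρ ^ k / (Nat.factorial k : ℝ)
        ≤ ∫ ρ in (0 : ℝ)..ξ, hill (k + 1) ρ :=
          intervalIntegral.integral_mono_on h0
            (Continuous.intervalIntegrable (by fun_prop) _ _) (hill_intervalIntegrable k _ _)
            fun ρ hρ => ih hρ.1 (hρ.2.trans_lt h1)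
      _ ≤ ∫ ρ in (ξ - 1)..ξ, hill (k + 1) ρ :=
          intervalIntegral.integral_mono_interval (by linarith) h0 le_rfl
            (Filter.Eventually.of_forall fun ρ => hill_nonneg k ρ) (hill_intervalIntegrable k _ _)

lemma hill_symm_of_ae (k : ℕ) (h : ∀ᵐ s : ℝ, hill (k + 1) ((k : ℝ) + 1 - s) = hill (k + 1) s)
    (s : ℝ) : hill (k + 2) ((k : ℝ) + 2 - s) = hill (k + 2) s := by
  rw [hill_succ_succ, hill_succ_succ]
  have h1 : ∫ u in (s - 1)..s, hill (k + 1) ((k : ℝ) + 1 - u)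
      = ∫ u in ((k : ℝ) + 1 - s)..((k : ℝ) + 1 - (s - 1)), hill (k + 1) u :=
    intervalIntegral.integral_comp_sub_left _ _
  have h2 : ∫ u in (s - 1)..s, hill (k + 1) ((k : ℝ) + 1 - u)
      = ∫ u in (s - 1)..s, hill (k + 1) u :=
    intervalIntegral.integral_congr_ae (h.mono fun u hu _ => hu)
  rw [← h2, h1]
  congr 1 <;> ring

lemma hill_symm_ae (k : ℕ) : ∀ᵐ s : ℝ, hill (k + 1) ((k : ℝ) + 1 - s) = hill (k + 1) s := by
  induction k with
  | zero =>
    filter_upwards [Measure.ae_ne volume (0 : ℝ), Measure.ae_ne volume (1 : ℝ)] with s h0 h1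
    simp only [zero_add, hill_one, Nat.cast_zero]
    congr 1
    refine propext ⟨fun h => ⟨?_, ?_⟩, fun h => ⟨?_, ?_⟩⟩
    · linarith
    · exact lt_of_le_of_ne (by linarith) h1
    · linarith
    · linarith [lt_of_le_of_ne h.1 h0.symm]
  | succ k ih =>
    refine Filter.Eventually.of_forall fun s => ?_
    have h := hill_symm_of_ae k ih s
    rw [← h]
    push_cast
    ring_nf

/-- The hill `m^k` is symmetric about `k / 2` (for `k = 1` only almost everywhere). -/
lemma hill_symm (k : ℕ) (s : ℝ) : hill (k + 2) ((k : ℝ) + 2 - s) = hill (k + 2) s :=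
  hill_symm_of_ae k (hill_symm_ae k) s

lemma hill_mono_of_shift (k : ℕ)
    (h : ∀ s : ℝ, s < ((k : ℝ) + 2) / 2 → hill (k + 1) (s - 1) ≤ hill (k + 1) s)
    {u v : ℝ} (huv : u ≤ v) (hv : v ≤ ((k : ℝ) + 2) / 2) : hill (k + 2) u ≤ hill (k + 2) v := by
  rw [hill_succ_succ, hill_succ_succ]
  have hI := hill_intervalIntegrable k
  have h1 : ∫ s in u..v, hill (k + 1) (s - 1) = ∫ s in (u - 1)..(v - 1), hill (k + 1) s :=
    intervalIntegral.integral_comp_sub_right _ _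
  have h2 : ∫ s in u..v, hill (k + 1) (s - 1) ≤ ∫ s in u..v, hill (k + 1) s := by
    refine intervalIntegral.integral_mono_on_of_le_Ioo huv ?_ (hI _ _)
      fun s hs => h s (hs.2.trans_le hv)
    simpa using (hI (u - 1) (v - 1)).comp_sub_right 1
  have h3 := intervalIntegral.integral_add_adjacent_intervals (hI (u - 1) u) (hI u v)
  have h4 := intervalIntegral.integral_add_adjacent_intervals (hI (u - 1) (v - 1)) (hI (v - 1) v)
  linarith

lemma hill_shift_le (k : ℕ) (s : ℝ) (hs : s < ((k : ℝ) + 2) / 2) :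
    hill (k + 1) (s - 1) ≤ hill (k + 1) s := by
  induction k generalizing s with
  | zero =>
    have hs' : s < 1 := by simpa using hs
    have h : hill 1 (s - 1) = 0 := by
      rw [hill_one, if_neg]
      rintro ⟨h, -⟩
      linarith
    simpa [h] using hill_nonneg 0 s
  | succ k ih =>
    push_cast at hs
    rcases le_total s (((k : ℝ) + 2) / 2) with h | h
    · exact hill_mono_of_shift k ih (by linarith) h
    · change hill (k + 2) (s - 1) ≤ hill (k + 2) s
      rw [← hill_symm k s]
      exact hill_mono_of_shift k ih (by linarith) (by linarith)

lemma hill_mono (k : ℕ) {u v : ℝ} (huv : u ≤ v) (hv : v ≤ ((k : ℝ) + 2) / 2) :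
    hill (k + 2) u ≤ hill (k + 2) v :=
  hill_mono_of_shift k (hill_shift_le k) huv hv

lemma pow_div_factorial_le_hill_of_mem (k : ℕ) {δ s : ℝ} (h0 : 0 < δ) (h1 : δ < 1)
    (hs : δ ≤ s) (hs' : s ≤ (k : ℝ) + 1 - δ) :
    δ ^ k / (Nat.factorial k : ℝ) ≤ hill (k + 1) s := by
  cases k with
  | zero =>
    have hs1 : s < 1 := by
      norm_num at hs'
      linarith
    simpa using pow_div_factorial_le_hill 0 (h0.le.trans hs) hs1
  | succ k =>
    refine (pow_div_factorial_le_hill (k + 1) h0.le h1).trans ?_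
    push_cast at hs'
    rcases le_total s (((k : ℝ) + 2) / 2) with h | h
    · exact hill_mono k hs h
    · change hill (k + 2) δ ≤ hill (k + 2) s
      rw [← hill_symm k s]
      exact hill_mono k (by linarith) (by linarith)

lemma rpow_neg_mul_eq_exp {B : ℝ} (hB : 0 < B) (α ρ : ℝ) :
    B ^ (-(ρ * α)) = Real.exp (-(α * Real.log B) * ρ) := by
  rw [Real.rpow_def_of_pos hB]
  ring_nf

lemma lamNorm_of_nonneg {B : ℝ} (hB : 0 < B) (α : ℝ) (k : ℕ) {ξ : ℝ} (hξ : 0 ≤ ξ) :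
    lamNorm B α k ξ
      = ∫ ρ in (0 : ℝ)..ξ, Real.exp (-(α * Real.log B) * ρ) * hill k (ξ - ρ) := by
  simp only [lamNorm, if_pos hξ, rpow_neg_mul_eq_exp hB]

lemma integral_exp_neg_mul {a : ℝ} (ha : a ≠ 0) (x : ℝ) :
    ∫ ρ in (0 : ℝ)..x, Real.exp (-a * ρ) = (1 - Real.exp (-a * x)) / a := by
  rw [intervalIntegral.integral_comp_mul_left (fun x => Real.exp x) (neg_ne_zero.mpr ha),
    integral_exp]
  simp only [mul_zero, Real.exp_zero, smul_eq_mul]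
  field_simp
  ring

lemma hill_comp_sub_left_intervalIntegrable (k : ℕ) (ξ a b : ℝ) :
    IntervalIntegrable (fun ρ => hill (k + 1) (ξ - ρ)) volume a b := by
  simpa using (hill_intervalIntegrable k (ξ - a) (ξ - b)).comp_sub_left ξ

lemma exp_mul_hill_intervalIntegrable (c : ℝ) (k : ℕ) (ξ a b : ℝ) :
    IntervalIntegrable (fun ρ => Real.exp (c * ρ) * hill (k + 1) (ξ - ρ)) volume a b :=
  (hill_comp_sub_left_intervalIntegrable k ξ a b).continuousOn_mul (by fun_prop)

lemma exp_integral_le {a : ℝ} (ha : 0 < a) (k : ℕ) {ξ : ℝ} (hξ : 0 ≤ ξ) :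
    ∫ ρ in (0 : ℝ)..ξ, Real.exp (-a * ρ) * hill (k + 1) (ξ - ρ) ≤ 1 / a := by
  calc _ ≤ ∫ ρ in (0 : ℝ)..ξ, Real.exp (-a * ρ) :=
        intervalIntegral.integral_mono_on hξ (exp_mul_hill_intervalIntegrable _ k ξ _ _)
          (Continuous.intervalIntegrable (by fun_prop) _ _)
          fun ρ _ => mul_le_of_le_one_right (Real.exp_pos _).le (hill_le_one k _)
    _ = (1 - Real.exp (-a * ξ)) / a := integral_exp_neg_mul ha.ne' ξ
    _ ≤ 1 / a := by
        gcongr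
        linarith [Real.exp_pos (-a * ξ)]

lemma le_exp_integral_of_large {a ε ξ : ℝ} (ha : 0 < a) (k : ℕ) (hε : 0 < ε) (hε1 : ε ≤ 1)
    (hξ : ε ≤ ξ) (hξ' : ξ ≤ (k : ℝ) + 1 - ε) (hlarge : Real.log 2 ≤ a * (ξ - ε / 2)) :
    ((2 : ℝ) ^ (k + 1))⁻¹ * ε ^ k / (Nat.factorial k : ℝ) / a
      ≤ ∫ ρ in (0 : ℝ)..ξ, Real.exp (-a * ρ) * hill (k + 1) (ξ - ρ) := by
  set c : ℝ := (ε / 2) ^ k / (Nat.factorial k : ℝ) with hc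
  have hc0 : 0 ≤ c := by positivity
  have hexp : Real.exp (-a * (ξ - ε / 2)) ≤ 1 / 2 := by
    calc Real.exp (-a * (ξ - ε / 2)) ≤ Real.exp (-Real.log 2) :=
          Real.exp_le_exp.mpr (by linarith)
      _ = 1 / 2 := by rw [Real.exp_neg, Real.exp_log two_pos, one_div]
  calc ((2 : ℝ) ^ (k + 1))⁻¹ * ε ^ k / (Nat.factorial k : ℝ) / a
      = (1 / 2) / a * c := by
        rw [hc, div_pow, pow_succ]
        field_simp
    _ ≤ (1 - Real.exp (-a * (ξ - ε / 2))) / a * c := by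
        gcongr
        linarith
    _ = ∫ ρ in (0 : ℝ)..(ξ - ε / 2), Real.exp (-a * ρ) * c := by
        rw [intervalIntegral.integral_mul_const, integral_exp_neg_mul ha.ne']
    _ ≤ ∫ ρ in (0 : ℝ)..(ξ - ε / 2), Real.exp (-a * ρ) * hill (k + 1) (ξ - ρ) :=
        intervalIntegral.integral_mono_on (by linarith)
          (Continuous.intervalIntegrable (by fun_prop) _ _)
          (exp_mul_hill_intervalIntegrable _ k ξ _ _)
          fun ρ hρ => mul_le_mul_of_nonneg_left
            (pow_div_factorial_le_hill_of_mem k (by linarith) (by linarith)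
              (by linarith [hρ.2]) (by linarith [hρ.1]))
            (Real.exp_pos _).le
    _ ≤ ∫ ρ in (0 : ℝ)..ξ, Real.exp (-a * ρ) * hill (k + 1) (ξ - ρ) :=
        intervalIntegral.integral_mono_interval le_rfl (by linarith) (by linarith)
          (Filter.Eventually.of_forall fun ρ =>
            mul_nonneg (Real.exp_pos _).le (hill_nonneg k _))
          (exp_mul_hill_intervalIntegrable _ k ξ _ _)

lemma le_exp_integral_of_small {a ε ξ : ℝ} (ha : Real.log 2 ≤ a) (k : ℕ) (hε : 0 < ε)
    (hε1 : ε ≤ 1) (hξ : ε ≤ ξ) (hsmall : a * (ξ - ε / 2) ≤ Real.log 2) :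
    ((2 : ℝ) ^ 4)⁻¹ * ε ^ (k + 1) / (Nat.factorial (k + 1) : ℝ) / a
      ≤ ∫ ρ in (0 : ℝ)..ξ, Real.exp (-a * ρ) * hill (k + 1) (ξ - ρ) := by
  have ha' : 1 / 4 ≤ a := by linarith [Real.log_two_gt_d9]
  have ha0 : 0 < a := by linarith
  have hexp : 1 / 4 ≤ Real.exp (-a * ξ) := by
    have h : a * (ε / 2) ≤ a * (ξ - ε / 2) := by
      gcongr
      linarith
    calc (1 / 4 : ℝ) = Real.exp (-Real.log 2 + -Real.log 2) := by
          rw [Real.exp_add, Real.exp_neg, Real.exp_log two_pos]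
          norm_num
      _ ≤ Real.exp (-a * ξ) := Real.exp_le_exp.mpr (by linarith)
  calc ((2 : ℝ) ^ 4)⁻¹ * ε ^ (k + 1) / (Nat.factorial (k + 1) : ℝ) / a
      = (((2 : ℝ) ^ 4)⁻¹ / a) * (ε ^ (k + 1) / (Nat.factorial (k + 1) : ℝ)) := by ring
    _ ≤ 1 / 4 * (ε ^ (k + 1) / (Nat.factorial (k + 1) : ℝ)) := by
        refine mul_le_mul_of_nonneg_right ?_ (by positivity)
        rw [div_le_iff₀ ha0]
        linarith
    _ = 1 / 4 * ∫ ρ in (0 : ℝ)..ε, ρ ^ k / (Nat.factorial k : ℝ) := by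
        rw [integral_pow_div_factorial]
    _ ≤ 1 / 4 * ∫ ρ in (0 : ℝ)..ε, hill (k + 1) ρ := by
        gcongr
        exact intervalIntegral.integral_mono_on_of_le_Ioo hε.le
          (Continuous.intervalIntegrable (by fun_prop) _ _) (hill_intervalIntegrable k _ _)
          fun ρ hρ => pow_div_factorial_le_hill k hρ.1.le (hρ.2.trans_le hε1)
    _ ≤ 1 / 4 * ∫ ρ in (0 : ℝ)..ξ, hill (k + 1) ρ := by
        gcongr
        exact intervalIntegral.integral_mono_interval le_rfl hε.le hξ
          (Filter.Eventually.of_forall fun ρ => hill_nonneg k ρ) (hill_intervalIntegrable k _ _)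
    _ = ∫ ρ in (0 : ℝ)..ξ, 1 / 4 * hill (k + 1) (ξ - ρ) := by
        rw [intervalIntegral.integral_const_mul, intervalIntegral.integral_comp_sub_left]
        simp
    _ ≤ ∫ ρ in (0 : ℝ)..ξ, Real.exp (-a * ρ) * hill (k + 1) (ξ - ρ) :=
        intervalIntegral.integral_mono_on (hε.le.trans hξ)
          ((hill_comp_sub_left_intervalIntegrable k ξ _ _).const_mul _)
          (exp_mul_hill_intervalIntegrable _ k ξ _ _)
          fun ρ hρ => mul_le_mul_of_nonneg_right
            (hexp.trans (Real.exp_le_exp.mpr (by nlinarith [hρ.2]))) (hill_nonneg k _)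

theorem lamNorm_bounds (B α : ℝ) (hB : 1 < B) (hα : 0 < α) (k : ℕ) (hk : 1 ≤ k) :
    (∀ ξ : ℝ, lamNorm B α k ξ ≤ 1 / (α * Real.log B)) ∧
    (∀ ε : ℝ, max (Real.log 2) (Real.log 16 / (k : ℝ)) ≤ α * Real.log B →
      0 < ε → ε ≤ 1 →
      (k ≤ 2 ∨ ∃ ξh : ℝ, ξh ∈ Set.Ioc (0 : ℝ) (k : ℝ) ∧ ε ≤ (k : ℝ) - ξh ∧
        MonotoneOn (lamNorm B α k) (Set.Ioo 0 ξh) ∧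
        AntitoneOn (lamNorm B α k) (Set.Ioo ξh (k : ℝ))) →
      ∀ ξ ∈ Set.Icc ε ((k : ℝ) - ε),
        min (((2 : ℝ) ^ 4)⁻¹ * ε ^ k / (Nat.factorial k : ℝ))
            (((2 : ℝ) ^ k)⁻¹ * ε ^ (k - 1) / (Nat.factorial (k - 1) : ℝ))
          / (α * Real.log B) ≤ lamNorm B α k ξ) := by
  obtain ⟨k, rfl⟩ : ∃ j, k = j + 1 := ⟨k - 1, by omega⟩
  have hB0 : 0 < B := by linarith
  have ha : 0 < α * Real.log B := mul_pos hα (Real.log_pos hB)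
  refine ⟨fun ξ => ?_, fun ε hmax hε hε1 _ ξ hξ => ?_⟩
  · rcases le_or_gt 0 ξ with h | h
    · rw [lamNorm_of_nonneg hB0 α _ h]
      exact exp_integral_le ha k h
    · rw [lamNorm, if_neg (not_le.mpr h)]
      positivity
  · have hlog : Real.log 2 ≤ α * Real.log B := (le_max_left _ _).trans hmax
    have hξ2 := hξ.2
    push_cast at hξ2
    rw [lamNorm_of_nonneg hB0 α _ (hε.le.trans hξ.1), Nat.add_sub_cancel]
    rcases le_total (Real.log 2) (α * Real.log B * (ξ - ε / 2)) with h | h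
    · exact (div_le_div_of_nonneg_right (min_le_right _ _) ha.le).trans
        (le_exp_integral_of_large ha k hε hε1 hξ.1 hξ2 h)
    · exact (div_le_div_of_nonneg_right (min_le_left _ _) ha.le).trans
        (le_exp_integral_of_small hlog k hε hε1 hξ.1 h)
end

section
/- Let 1 < B < C, let k ≥ 1 be an integer and x > 0 a real. Then π_{B,C}^k(x) ≤ κ_{B,C}^k(x) ≤ k!·π_{B,C}^k(x), and |π_{B,C}^k(x) − κ_{B,C}^k(x)/k!| ≤ 2^{k−1}·x/B. -/
open MeasureTheory

/-- `piBC B C k x` counts positive integers `n ≤ x` that are products of exactly `k`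
primes (with multiplicity), all lying in `(B, C]`. -/
noncomputable def piBC (B C : ℝ) (k : ℕ) (x : ℝ) : ℕ :=
  Set.ncard {n : ℕ | 0 < n ∧ (n : ℝ) ≤ x ∧
    ∃ p : Fin k → ℕ, (∀ i, (p i).Prime ∧ B < (p i : ℝ) ∧ (p i : ℝ) ≤ C) ∧ n = ∏ i, p i}

/-- Two tuples whose lists of values are permutations of each other differ by a permutation of
the indices. -/
theorem exists_perm_comp_eq_of_ofFn_perm {α : Type*} [LinearOrder α] {k : ℕ} {p q : Fin k → α}
    (h : (List.ofFn p).Perm (List.ofFn q)) : ∃ σ : Equiv.Perm (Fin k), q ∘ σ = p := by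
  have key : p ∘ Tuple.sort p = q ∘ Tuple.sort q := by
    refine List.ofFn_injective ?_
    exact ((((Tuple.sort p).ofFn_comp_perm p).trans h).trans
      ((Tuple.sort q).ofFn_comp_perm q).symm).eq_of_pairwise'
      (Tuple.monotone_sort p).sortedLE_ofFn.pairwise (Tuple.monotone_sort q).sortedLE_ofFn.pairwise
  refine ⟨(Tuple.sort p).symm.trans (Tuple.sort q), ?_⟩
  funext i
  have := congrFun key ((Tuple.sort p).symm i)
  simpa using this.symm

/-- Unique factorization for tuples of primes. -/
theorem exists_perm_comp_eq_of_prod_eq {k : ℕ} {p q : Fin k → ℕ} (hp : ∀ i, (p i).Prime)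
    (hq : ∀ i, (q i).Prime) (h : ∏ i, p i = ∏ i, q i) :
    ∃ σ : Equiv.Perm (Fin k), q ∘ σ = p := by
  apply exists_perm_comp_eq_of_ofFn_perm
  have h1 : (List.ofFn p).Perm (∏ i, p i).primeFactorsList :=
    Nat.primeFactorsList_unique (List.prod_ofFn (f := p)) (by simpa [List.mem_ofFn] using hp)
  have h2 : (List.ofFn q).Perm (∏ i, q i).primeFactorsList :=
    Nat.primeFactorsList_unique (List.prod_ofFn (f := q)) (by simpa [List.mem_ofFn] using hq)
  rw [h] at h1
  exact h1.trans h2.symm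

/-- Counting via fibres: if every fibre of `f` on `s` has at most `c` elements, and exactly `c`
elements outside of `t`, then the size of the image differs from `#s / c` by at most `#t`. -/
theorem abs_card_image_sub_card_div_le {α β : Type*} [DecidableEq β] (f : α → β) (s : Finset α)
    (t : Finset β) {c : ℕ} (hc : 0 < c) (hle : ∀ b, (s.filter (f · = b)).card ≤ c)
    (heq : ∀ b ∈ s.image f, b ∉ t → (s.filter (f · = b)).card = c) :
    |((s.image f).card : ℝ) - (s.card : ℝ) / c| ≤ t.card := by
  have hc' : (0 : ℝ) < c := by exact_mod_cast hc
  have e : ((s.image f).card : ℝ) - (s.card : ℝ) / c =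
      ∑ b ∈ s.image f, (1 - ((s.filter (f · = b)).card : ℝ) / c) := by
    rw [Finset.sum_sub_distrib, ← Finset.sum_div, ← Nat.cast_sum,
      ← Finset.card_eq_sum_card_image]
    simp
  have hr : ∀ b, ((s.filter (f · = b)).card : ℝ) / c ≤ 1 := fun b => by
    rw [div_le_one hc']
    exact_mod_cast hle b
  rw [e, abs_of_nonneg (Finset.sum_nonneg fun b _ => sub_nonneg.2 (hr b))]
  calc ∑ b ∈ s.image f, (1 - ((s.filter (f · = b)).card : ℝ) / c)
      ≤ ∑ b ∈ s.image f, (if b ∈ t then (1 : ℝ) else 0) := by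
        refine Finset.sum_le_sum fun b hb => ?_
        split_ifs with hbt
        · have : (0 : ℝ) ≤ ((s.filter (f · = b)).card : ℝ) / c := by positivity
          linarith
        · rw [heq b hb hbt, div_self hc'.ne', sub_self]
    _ = (((s.image f).filter (· ∈ t)).card : ℝ) := by rw [Finset.sum_boole]
    _ ≤ t.card := by
        exact_mod_cast Finset.card_le_card fun b hb => (Finset.mem_filter.1 hb).2

/-- The number of `n ≤ N` divisible by the square of some integer in `(M, L]` is at most `N / M`. -/
theorem card_biUnion_sq_dvd_le {M : ℕ} (hM : M ≠ 0) (L N : ℕ) :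
    ((((Finset.Ioc M L).biUnion fun m => (Finset.Ioc 0 N).filter (m ^ 2 ∣ ·)).card : ℕ) : ℝ) ≤
      N / M := by
  have hN : (0 : ℝ) ≤ N / M := by positivity
  rcases le_total L M with h | h
  · simpa [Finset.Ioc_eq_empty_of_le h] using hN
  calc ((((Finset.Ioc M L).biUnion fun m => (Finset.Ioc 0 N).filter (m ^ 2 ∣ ·)).card : ℕ) : ℝ)
      ≤ ((∑ m ∈ Finset.Ioc M L, N / m ^ 2 : ℕ) : ℝ) := by
        refine Nat.cast_le.2 (Finset.card_biUnion_le.trans (Finset.sum_le_sum fun m _ => ?_))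
        rw [Nat.Ioc_filter_dvd_card_eq_div]
    _ ≤ ∑ m ∈ Finset.Ioc M L, (N : ℝ) * ((m : ℝ) ^ 2)⁻¹ := by
        push_cast
        refine Finset.sum_le_sum fun m _ => Nat.cast_div_le.trans ?_
        rw [Nat.cast_pow, div_eq_mul_inv]
    _ = N * ∑ m ∈ Finset.Ioc M L, ((m : ℝ) ^ 2)⁻¹ := by rw [Finset.mul_sum]
    _ ≤ N * (M : ℝ)⁻¹ := by
        gcongr
        refine (sum_Ioc_inv_sq_le_sub hM h).trans ?_
        have : (0 : ℝ) ≤ (L : ℝ)⁻¹ := by positivity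
        linarith
    _ = N / M := by rw [div_eq_mul_inv]

theorem piBC_vs_kappa (B C : ℝ) (hB : 1 < B) (hBC : B < C)
    (k : ℕ) (hk : 1 ≤ k) (x : ℝ) (hx : 0 < x) :
    piBC B C k x ≤ kappa B C k x ∧
    kappa B C k x ≤ Nat.factorial k * piBC B C k x ∧
    |(piBC B C k x : ℝ) - (kappa B C k x : ℝ) / (Nat.factorial k : ℝ)| ≤
      2 ^ (k - 1) * x / B := by
  classical
  have hfin : {p : Fin k → ℕ | (∀ i, (p i).Prime ∧ B < (p i : ℝ) ∧ (p i : ℝ) ≤ C) ∧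
      ((∏ i, p i : ℕ) : ℝ) ≤ x}.Finite :=
    (Set.finite_Iic (fun _ : Fin k => ⌊C⌋₊)).subset fun p hp i => Nat.le_floor (hp.1 i).2.2
  set s : Finset (Fin k → ℕ) := hfin.toFinset
  have mem_s : ∀ p, p ∈ s ↔ (∀ i, (p i).Prime ∧ B < (p i : ℝ) ∧ (p i : ℝ) ≤ C) ∧
      ((∏ i, p i : ℕ) : ℝ) ≤ x := fun p => hfin.mem_toFinset
  let f : (Fin k → ℕ) → ℕ := fun p => ∏ i, p i
  have hkappa : kappa B C k x = s.card := Set.ncard_eq_toFinset_card _ hfin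
  have hpi : piBC B C k x = (s.image f).card := by
    rw [piBC, ← Set.ncard_coe_finset]
    congr 1
    ext n
    simp only [Set.mem_ofPred_eq, Finset.coe_image, Set.mem_image, Finset.mem_coe, mem_s, f]
    constructor
    · rintro ⟨-, hn, p, hp, rfl⟩
      exact ⟨p, ⟨hp, hn⟩, rfl⟩
    · rintro ⟨p, ⟨hp, hn⟩, rfl⟩
      exact ⟨Finset.prod_pos fun i _ => (hp i).1.pos, hn, p, hp, rfl⟩
  have hfiber : ∀ p ∈ s, s.filter (f · = f p) =
      Finset.univ.image fun σ : Equiv.Perm (Fin k) => p ∘ σ := by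
    intro p hp
    ext q
    simp only [Finset.mem_filter, Finset.mem_image, Finset.mem_univ, true_and]
    constructor
    · rintro ⟨hq, hqp⟩
      exact exists_perm_comp_eq_of_prod_eq (fun i => (((mem_s q).1 hq).1 i).1)
        (fun i => (((mem_s p).1 hp).1 i).1) hqp
    · rintro ⟨σ, rfl⟩
      have hσ : ∏ i, (p ∘ σ) i = ∏ i, p i := Equiv.prod_comp σ p
      refine ⟨(mem_s _).2 ⟨fun i => ((mem_s p).1 hp).1 (σ i), ?_⟩, hσ⟩
      rw [hσ]
      exact ((mem_s p).1 hp).2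
  have hle : ∀ n, (s.filter (f · = n)).card ≤ k.factorial := by
    intro n
    rcases (s.filter (f · = n)).eq_empty_or_nonempty with h | ⟨p, hp⟩
    · simp [h]
    · obtain ⟨hps, rfl⟩ := Finset.mem_filter.1 hp
      rw [hfiber p hps]
      exact Finset.card_image_le.trans (by simp [Finset.card_univ, Fintype.card_perm])
  have hinj : ∀ p ∈ s, Function.Injective p → (s.filter (f · = f p)).card = k.factorial := by
    intro p hps hp
    rw [hfiber p hps, Finset.card_image_of_injective, Finset.card_univ, Fintype.card_perm,
      Fintype.card_fin]
    exact fun σ τ h => Equiv.ext fun i => hp (congrFun h i)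
  have hfac : 0 < k.factorial := k.factorial_pos
  have hB0 : 0 < B := by linarith
  rw [hkappa, hpi]
  refine ⟨Finset.card_image_le, ?_, ?_⟩
  · rw [Finset.card_eq_sum_card_image f s, mul_comm]
    exact Finset.sum_le_card_nsmul _ _ _ fun n _ => hle n
  obtain rfl | hk2 : k = 1 ∨ 2 ≤ k := by omega
  · refine (abs_card_image_sub_card_div_le f s ∅ hfac hle ?_).trans ?_
    · intro n hn _
      obtain ⟨p, hp, rfl⟩ := Finset.mem_image.1 hn
      exact hinj p hp (Function.injective_of_subsingleton p)
    · simp only [Finset.card_empty, Nat.cast_zero]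
      positivity
  have hM : 1 ≤ ⌊B⌋₊ := Nat.le_floor (by simpa using hB.le)
  refine (abs_card_image_sub_card_div_le f s ((Finset.Ioc ⌊B⌋₊ ⌊C⌋₊).biUnion fun m =>
    (Finset.Ioc 0 ⌊x⌋₊).filter (m ^ 2 ∣ ·)) hfac hle ?_).trans ?_
  · intro n hn hnt
    obtain ⟨p, hp, rfl⟩ := Finset.mem_image.1 hn
    refine hinj p hp fun i j hij => ?_
    by_contra hne
    obtain ⟨hp1, hp2⟩ := (mem_s p).1 hp
    refine hnt (Finset.mem_biUnion.2 ⟨p i, Finset.mem_Ioc.2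
      ⟨(Nat.floor_lt hB0.le).2 (hp1 i).2.1, Nat.le_floor (hp1 i).2.2⟩,
      Finset.mem_filter.2 ⟨Finset.mem_Ioc.2
        ⟨Finset.prod_pos fun i _ => (hp1 i).1.pos, Nat.le_floor hp2⟩, ?_⟩⟩)
    have : ∏ l ∈ {i, j}, p l ∣ ∏ l, p l :=
      Finset.prod_dvd_prod_of_subset _ _ _ (Finset.subset_univ _)
    rwa [Finset.prod_pair hne, ← hij, ← sq] at this
  · refine (card_biUnion_sq_dvd_le (by omega) _ _).trans ?_
    have hM' : (1 : ℝ) ≤ (⌊B⌋₊ : ℝ) := by exact_mod_cast hM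
    have hB2 : B ≤ 2 * ⌊B⌋₊ := by linarith [Nat.lt_floor_add_one B]
    have h2 : (2 : ℝ) ≤ 2 ^ (k - 1) := le_self_pow₀ (by norm_num) (by omega)
    calc (⌊x⌋₊ : ℝ) / ⌊B⌋₊ ≤ x / ⌊B⌋₊ := by gcongr; exact Nat.floor_le hx.le
      _ ≤ 2 * x / B := by
        rw [div_le_div_iff₀ (by linarith) hB0]
        nlinarith
      _ ≤ 2 ^ (k - 1) * x / B := by gcongr
end
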